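/- arXiv:1311.2232 — 2 statements merged into one kernel-verified Lean document; each statement's English description precedes it below -/
import Mathlib

section
/- Let Γ be a finite simplicial graph defining the right-angled Artin group A = A(Γ), and let PΣ(A) be its pure symmetric automorphism group. Then PΣ(A) is isomorphic to a right-angled Artin group (i.e., there exists a finite simplicial graph Δ with PΣ(A) ≅ A(Δ)) if and only if Γ contains no separating intersection of links (no SIL). -/
open SimpleGraph

/-- The star of a vertex: the vertex together with its neighbours. -/
def Gstar {V : Type} (Γ : SimpleGraph V) (a : V) : Set V := insert a (Γ.neighborSet a)

/-- The set of vertices whose star is the whole vertex set. -/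
def Zset {V : Type} (Γ : SimpleGraph V) : Set V := {v | Gstar Γ v = Set.univ}

/-- `K` is (the vertex set of) a connected component of the full subgraph of `Γ`
induced on the vertex set `S`. -/
def IsCompOf {V : Type} (Γ : SimpleGraph V) (S K : Set V) : Prop :=
  ∃ c : (Γ.induce S).ConnectedComponent, K = Subtype.val '' c.supp

/-- The defining relators of the right-angled Artin group of `Γ`. -/
def raagRels {V : Type} (Γ : SimpleGraph V) : Set (FreeGroup V) :=
  {r | ∃ a b : V, Γ.Adj a b ∧
    r = FreeGroup.of a * FreeGroup.of b * (FreeGroup.of a)⁻¹ * (FreeGroup.of b)⁻¹}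

/-- The right-angled Artin group `A(Γ)`. -/
abbrev RAAG {V : Type} (Γ : SimpleGraph V) : Type := PresentedGroup (raagRels Γ)

/-- The generator of `A(Γ)` corresponding to a vertex `v`. -/
def raagGen {V : Type} (Γ : SimpleGraph V) (v : V) : RAAG Γ := PresentedGroup.of v

/-- The pure symmetric automorphism group: automorphisms sending each standard
generator to a conjugate of itself. -/
def PSA {V : Type} (Γ : SimpleGraph V) : Subgroup (MulAut (RAAG Γ)) where
  carrier := {φ | ∀ v : V, IsConj (raagGen Γ v) (φ (raagGen Γ v))}
  one_mem' := fun v => IsConj.refl _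
  mul_mem' := by
    intro φ ψ hφ hψ v
    have h2 : IsConj (φ (raagGen Γ v)) (φ (ψ (raagGen Γ v))) :=
      φ.toMonoidHom.map_isConj (hψ v)
    simpa [MulAut.mul_apply] using (hφ v).trans h2
  inv_mem' := by
    intro φ hφ v
    have h := (φ⁻¹ : MulAut (RAAG _)).toMonoidHom.map_isConj (hφ v)
    simp only [MulEquiv.toMonoidHom_eq_coe, MonoidHom.coe_coe, MulAut.inv_def,
      MulEquiv.symm_apply_apply] at h
    exact h.symm

/-- `φ` is the partial conjugation `π_{a,K}`. -/
def IsPartialConj {V : Type} (Γ : SimpleGraph V) (a : V) (K : Set V)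
    (φ : MulAut (RAAG Γ)) : Prop :=
  IsCompOf Γ (Gstar Γ a)ᶜ K ∧
  (∀ v ∈ K, φ (raagGen Γ v) = (raagGen Γ a)⁻¹ * raagGen Γ v * raagGen Γ a) ∧
  (∀ v ∉ K, φ (raagGen Γ v) = raagGen Γ v)

/-- Combinatorial data (acting letter, domain) of the partial conjugations. -/
def PCSet {V : Type} (Γ : SimpleGraph V) : Set (V × Set V) :=
  {p | IsCompOf Γ (Gstar Γ p.1)ᶜ p.2}

/-- A non-trivial admissible partition (for p-sets). -/
def IsAdmissiblePartition {V : Type} (Q₁ Q₂ : Set (V × Set V)) : Prop :=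
  Disjoint Q₁ Q₂ ∧ Q₁.Nonempty ∧ Q₂.Nonempty ∧
    ∀ p ∈ Q₁, ∀ q ∈ Q₂, p.1 ∈ q.2 ∧ q.1 ∈ p.2

/-- A p-set of partial conjugations. -/
def IsPSet {V : Type} (Γ : SimpleGraph V) (Q : Set (V × Set V)) : Prop :=
  Q ⊆ PCSet Γ ∧
  (∀ a : V, {p ∈ Q | p.1 = a}.Subsingleton) ∧
  ∃ Q₁ Q₂ : Set (V × Set V), Q₁ ∪ Q₂ = Q ∧ IsAdmissiblePartition Q₁ Q₂

/-- A non-trivial admissible partition (for δ-p-sets). -/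
def IsDeltaAdmissiblePartition {V : Type} (Q₁ Q₂ : Set (V × Set V)) : Prop :=
  Disjoint Q₁ Q₂ ∧ Q₁.Nonempty ∧ Q₂.Nonempty ∧
    ∀ p ∈ Q₁, ∀ q ∈ Q₂, p.1 ∈ q.2 ∨ q.1 ∈ p.2 ∨ p.2 = q.2

/-- A δ-p-set of partial conjugations. -/
def IsDeltaPSet {V : Type} (Γ : SimpleGraph V) (Q : Set (V × Set V)) : Prop :=
  Q ⊆ PCSet Γ ∧
  (∀ a : V, a ∉ Zset Γ →
    ({p ∈ Q | p.1 = a}.ncard = 0 ∨ {p ∈ Q | p.1 = a}.ncard = 2)) ∧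
  ∃ Q₁ Q₂ : Set (V × Set V), Q₁ ∪ Q₂ = Q ∧ IsDeltaAdmissiblePartition Q₁ Q₂

/-- `Γ` has a separating intersection of links. -/
def HasSIL {V : Type} (Γ : SimpleGraph V) : Prop :=
  ∃ a b : V, a ≠ b ∧ ¬Γ.Adj a b ∧
    ∃ M : Set V, IsCompOf Γ (Γ.neighborSet a ∩ Γ.neighborSet b)ᶜ M ∧ a ∉ M ∧ b ∉ M

/-- The full subgraph spanned by `U` is dominating. -/
def Dominating {V : Type} (Γ : SimpleGraph V) (U : Set V) : Prop :=
  ∀ v : V, v ∈ U ∨ ∃ u ∈ U, Γ.Adj v u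

/-- The full subgraph spanned by `U` is disconnected or non-dominating. -/
def Missing {V : Type} (Γ : SimpleGraph V) (U : Set V) : Prop :=
  ¬(Γ.induce U).Connected ∨ ¬Dominating Γ U

namespace RaagPSA

section Basics

variable {V : Type} {Γ : SimpleGraph V}

/-- The homomorphism out of `A(Γ)` determined by commuting images of adjacent vertices. -/
def raagLift {G : Type*} [Group G] (f : V → G)
    (h : ∀ a b, Γ.Adj a b → Commute (f a) (f b)) : RAAG Γ →* G :=
  PresentedGroup.toGroup (f := f) (by
    rintro r ⟨a, b, hab, rfl⟩
    simp only [map_mul, map_inv, FreeGroup.lift_apply_of]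
    rw [(h a b hab).eq]; group)

@[simp] theorem raagLift_gen {G : Type*} [Group G] (f : V → G)
    (h : ∀ a b, Γ.Adj a b → Commute (f a) (f b)) (v : V) :
    raagLift f h (raagGen Γ v) = f v :=
  PresentedGroup.toGroup.of _

theorem raag_hom_ext {G : Type*} [Group G] {f g : RAAG Γ →* G}
    (h : ∀ v, f (raagGen Γ v) = g (raagGen Γ v)) : f = g :=
  PresentedGroup.ext h

theorem gen_commute {a b : V} (h : Γ.Adj a b) : Commute (raagGen Γ a) (raagGen Γ b) := by
  have : (PresentedGroup.mk (raagRels Γ))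
      (FreeGroup.of a * FreeGroup.of b * (FreeGroup.of a)⁻¹ * (FreeGroup.of b)⁻¹) = 1 :=
    PresentedGroup.one_of_mem ⟨a, b, h, rfl⟩
  simp only [map_mul, map_inv] at this
  change raagGen Γ a * raagGen Γ b * (raagGen Γ a)⁻¹ * (raagGen Γ b)⁻¹ = 1 at this
  rw [mul_inv_eq_one, mul_inv_eq_iff_eq_mul] at this
  exact this

/-- The generator `v` or its inverse, according to a sign. -/
def letter (Γ : SimpleGraph V) (v : V) (b : Bool) : RAAG Γ :=
  if b then raagGen Γ v else (raagGen Γ v)⁻¹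

@[simp] theorem letter_true (v : V) : letter Γ v true = raagGen Γ v := rfl

@[simp] theorem letter_false (v : V) : letter Γ v false = (raagGen Γ v)⁻¹ := rfl

theorem letter_not (v : V) (b : Bool) : letter Γ v (!b) = (letter Γ v b)⁻¹ := by
  cases b <;> simp

theorem letter_commute {v w : V} (h : Γ.Adj v w) (b c : Bool) :
    Commute (letter Γ v b) (letter Γ w c) := by
  have := gen_commute h
  cases b <;> cases c <;> simp [this]

/-- The group element spelled by a word. -/
def wordProd (Γ : SimpleGraph V) (l : List (V × Bool)) : RAAG Γ :=
  (l.map fun x => letter Γ x.1 x.2).prod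

@[simp] theorem wordProd_nil : wordProd Γ [] = 1 := rfl

@[simp] theorem wordProd_cons (x : V × Bool) (l : List (V × Bool)) :
    wordProd Γ (x :: l) = letter Γ x.1 x.2 * wordProd Γ l := by
  simp [wordProd]

@[simp] theorem wordProd_append (l l' : List (V × Bool)) :
    wordProd Γ (l ++ l') = wordProd Γ l * wordProd Γ l' := by
  simp [wordProd]

/-- The subgroup generated by a set of vertices. -/
def special (Γ : SimpleGraph V) (S : Set V) : Subgroup (RAAG Γ) :=
  Subgroup.closure (raagGen Γ '' S)

theorem letter_mem_special {S : Set V} {v : V} (h : v ∈ S) (b : Bool) :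
    letter Γ v b ∈ special Γ S := by
  have : raagGen Γ v ∈ special Γ S := Subgroup.subset_closure ⟨v, h, rfl⟩
  cases b <;> simp [this]

theorem special_mono {S T : Set V} (h : S ⊆ T) : special Γ S ≤ special Γ T :=
  Subgroup.closure_mono (Set.image_mono h)

theorem wordProd_mem_special {S : Set V} {l : List (V × Bool)} (h : ∀ x ∈ l, x.1 ∈ S) :
    wordProd Γ l ∈ special Γ S := by
  induction l with
  | nil => exact one_mem _
  | cons x l ih =>
    rw [wordProd_cons]
    exact mul_mem (letter_mem_special (h x (by simp)) _) (ih fun y hy => h y (by simp [hy]))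

theorem exists_word_inv (l : List (V × Bool)) :
    ∃ l' : List (V × Bool), l'.length = l.length ∧ (∀ x ∈ l', ∃ y ∈ l, y.1 = x.1) ∧
      wordProd Γ l' = (wordProd Γ l)⁻¹ := by
  induction l with
  | nil => exact ⟨[], rfl, by simp, by simp⟩
  | cons x l ih =>
    obtain ⟨l', h0, h1, h2⟩ := ih
    refine ⟨l' ++ [(x.1, !x.2)], by simp [h0], ?_, ?_⟩
    · intro y hy
      simp only [List.mem_append, List.mem_singleton] at hy
      rcases hy with hy | rfl
      · obtain ⟨z, hz, e⟩ := h1 y hy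
        exact ⟨z, by simp [hz], e⟩
      · exact ⟨x, by simp, rfl⟩
    · simp [h2, letter_not]

theorem exists_word_of_mem_special {S : Set V} {g : RAAG Γ} (h : g ∈ special Γ S) :
    ∃ l : List (V × Bool), (∀ x ∈ l, x.1 ∈ S) ∧ wordProd Γ l = g := by
  induction h using Subgroup.closure_induction with
  | mem x hx =>
    obtain ⟨v, hv, rfl⟩ := hx
    exact ⟨[(v, true)], by simpa using hv, by simp⟩
  | one => exact ⟨[], by simp, by simp⟩
  | mul x y _ _ hx hy =>
    obtain ⟨l, h1, rfl⟩ := hx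
    obtain ⟨l', h1', rfl⟩ := hy
    refine ⟨l ++ l', ?_, by simp⟩
    intro z hz
    rcases List.mem_append.1 hz with hz | hz
    exacts [h1 z hz, h1' z hz]
  | inv x _ hx =>
    obtain ⟨l, h1, rfl⟩ := hx
    obtain ⟨l', -, h2, h3⟩ := exists_word_inv (Γ := Γ) l
    refine ⟨l', ?_, h3⟩
    intro z hz
    obtain ⟨y, hy, e⟩ := h2 z hz
    exact e ▸ h1 y hy

theorem special_univ : special Γ Set.univ = ⊤ := by
  rw [special, Set.image_univ]
  exact PresentedGroup.closure_range_of _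

theorem exists_word (g : RAAG Γ) : ∃ l : List (V × Bool), wordProd Γ l = g := by
  obtain ⟨l, -, h⟩ := exists_word_of_mem_special (S := Set.univ) (g := g)
    (by rw [special_univ]; trivial)
  exact ⟨l, h⟩

/-- A generator commutes with every element supported on its star. -/
theorem commute_of_mem_special {S : Set V} {v : V} (hS : S ⊆ Gstar Γ v) {g : RAAG Γ}
    (hg : g ∈ special Γ S) (b : Bool) : Commute (letter Γ v b) g := by
  suffices special Γ S ≤ Subgroup.centralizer {letter Γ v b} by
    have := Subgroup.mem_centralizer_iff.1 (this hg) _ rfl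
    exact this
  rw [special, Subgroup.closure_le]
  rintro _ ⟨w, hw, rfl⟩
  rw [SetLike.mem_coe, Subgroup.mem_centralizer_iff]
  rintro _ rfl
  rcases hS hw with rfl | h
  · cases b <;> simp
  · exact (letter_commute h b true).eq

/-- The word length. -/
noncomputable def len (g : RAAG Γ) : ℕ :=
  sInf {n | ∃ l : List (V × Bool), wordProd Γ l = g ∧ l.length = n}

theorem exists_word_len (g : RAAG Γ) :
    ∃ l : List (V × Bool), wordProd Γ l = g ∧ l.length = len g := by
  obtain ⟨l, hl⟩ := exists_word g
  exact Nat.sInf_mem (s := {n | ∃ l : List (V × Bool), wordProd Γ l = g ∧ l.length = n})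
    ⟨_, l, hl, rfl⟩

theorem len_le (l : List (V × Bool)) : len (wordProd Γ l) ≤ l.length :=
  Nat.sInf_le ⟨l, rfl, rfl⟩

theorem len_inv (g : RAAG Γ) : len g⁻¹ = len g := by
  have key : ∀ h : RAAG Γ, len h⁻¹ ≤ len h := by
    intro h
    obtain ⟨l, rfl, hl⟩ := exists_word_len h
    obtain ⟨l', h1, -, h2⟩ := exists_word_inv (Γ := Γ) l
    rw [← h2, ← hl, ← h1]
    exact len_le l'
  exact le_antisymm (key g) (by simpa using key g⁻¹)

theorem eq_one_of_len_eq_zero {g : RAAG Γ} (h : len g = 0) : g = 1 := by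
  obtain ⟨l, rfl, hl⟩ := exists_word_len g
  rw [h, List.length_eq_zero_iff] at hl
  simp [hl]

end Basics

section Piles

open scoped Classical

variable {V : Type} (Γ : SimpleGraph V)

/-- Put a signed bead on the stack of `x`, and a blank one on each stack not commuting with it. -/
noncomputable def pilePush (x : V) (b : Bool) (p : V → List (Option Bool)) :
    V → List (Option Bool) :=
  fun y => if y = x then some b :: p y else if Γ.Adj x y then p y else none :: p y

/-- Remove the top bead from the stack of `x` and each stack not commuting with it. -/
noncomputable def pilePop (x : V) (p : V → List (Option Bool)) : V → List (Option Bool) :=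
  fun y => if y = x then (p y).tail else if Γ.Adj x y then p y else (p y).tail

/-- Multiplication by a letter on the level of piles. -/
noncomputable def pileOp (x : V) (b : Bool) (p : V → List (Option Bool)) :
    V → List (Option Bool) :=
  if (p x).head? = some (some !b) then pilePop Γ x p else pilePush Γ x b p

/-- `Piled Γ g p`: the pile `p` is obtained from a reduced word for `g`. -/
inductive Piled : RAAG Γ → (V → List (Option Bool)) → Prop
  | one : Piled 1 (fun _ => [])
  | push {g : RAAG Γ} {p : V → List (Option Bool)} (x : V) (b : Bool) (hp : Piled g p)
      (hx : (p x).head? ≠ some (some !b)) : Piled (letter Γ x b * g) (pilePush Γ x b p)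

variable {Γ}

theorem pilePop_push (x : V) (b : Bool) (p : V → List (Option Bool)) :
    pilePop Γ x (pilePush Γ x b p) = p := by
  funext y
  by_cases h : y = x <;> by_cases hadj : Γ.Adj x y <;> simp [pilePop, pilePush, hadj, h]

/-- A signed bead on top of a stack can be removed. -/
theorem Piled.exists_of_head {g : RAAG Γ} {p : V → List (Option Bool)} (hp : Piled Γ g p)
    {x : V} {b : Bool} (hx : (p x).head? = some (some b)) :
    ∃ g' p', Piled Γ g' p' ∧ (p' x).head? ≠ some (some !b) ∧ p = pilePush Γ x b p' ∧
      g = letter Γ x b * g' := by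
  induction hp with
  | one => simp at hx
  | @push g q y c hq hy ih =>
    by_cases hxy : x = y
    · subst hxy
      have : c = b := by simpa [pilePush] using hx
      subst this
      exact ⟨g, q, hq, hy, rfl, rfl⟩
    by_cases ha : Γ.Adj y x
    · have hx' : (q x).head? = some (some b) := by simpa [pilePush, hxy, ha] using hx
      obtain ⟨g', p', h1, h2, h3, h4⟩ := ih hx'
      have ha' := ha.symm
      refine ⟨letter Γ y c * g', pilePush Γ y c p', Piled.push y c h1 ?_, ?_, ?_, ?_⟩
      · rw [h3] at hy
        simpa [pilePush, Ne.symm hxy, ha'] using hy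
      · simpa [pilePush, hxy, ha] using h2
      · rw [h3]
        funext z
        by_cases hzx : z = x
        · subst hzx; simp [pilePush, hxy, ha]
        by_cases hzy : z = y
        · subst hzy; simp [pilePush, Ne.symm hxy, ha']
        by_cases hxz : Γ.Adj x z <;> by_cases hyz : Γ.Adj y z <;>
          simp [pilePush, hzx, hzy, hxz, hyz]
      · rw [h4, ← mul_assoc, ← mul_assoc, (letter_commute ha c b).eq]
    · simp [pilePush, hxy, ha] at hx

theorem Piled.eq_none_cons {g : RAAG Γ} {p : V → List (Option Bool)} (hp : Piled Γ g p)
    {x z : V} (hzx : z ≠ x) (ha : ¬Γ.Adj x z) {b : Bool} (hx : (p x).head? = some (some b)) :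
    none :: (p z).tail = p z := by
  obtain ⟨g', p', h1, h2, rfl, h4⟩ := hp.exists_of_head hx
  simp [pilePush, hzx, ha]

theorem Piled.op_comm {g : RAAG Γ} {p : V → List (Option Bool)} (hp : Piled Γ g p) {x y : V}
    (h : Γ.Adj x y) (b c : Bool) :
    pileOp Γ x b (pileOp Γ y c p) = pileOp Γ y c (pileOp Γ x b p) := by
  have hne : x ≠ y := h.ne
  have hx : ∀ q, pileOp Γ y c q x = q x := by
    intro q
    unfold pileOp pilePop pilePush
    split_ifs <;> simp [hne, h.symm]
  have hy : ∀ q, pileOp Γ x b q y = q y := by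
    intro q
    unfold pileOp pilePop pilePush
    split_ifs <;> simp [hne.symm, h]
  have e1 : ∀ q, pileOp Γ x b q = fun z => if (q x).head? = some (some !b)
      then pilePop Γ x q z else pilePush Γ x b q z := by
    intro q; funext z; unfold pileOp; split_ifs <;> rfl
  have e2 : ∀ q, pileOp Γ y c q = fun z => if (q y).head? = some (some !c)
      then pilePop Γ y q z else pilePush Γ y c q z := by
    intro q; funext z; unfold pileOp; split_ifs <;> rfl
  funext z
  rw [e1 (pileOp Γ y c p), e2 (pileOp Γ x b p)]
  simp only [hx, hy]
  rw [e1 p, e2 p]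
  unfold pilePop pilePush
  have := h.symm
  by_cases hzx : z = x
  · subst hzx
    by_cases h1 : (p z).head? = some (some !b) <;>
    by_cases h2 : (p y).head? = some (some !c) <;> simp [h1, h2, hne, this]
  by_cases hzy : z = y
  · subst hzy
    by_cases h1 : (p x).head? = some (some !b) <;>
    by_cases h2 : (p z).head? = some (some !c) <;> simp [h1, h2, hne.symm, h]
  by_cases hxz : Γ.Adj x z <;> by_cases hyz : Γ.Adj y z <;>
    by_cases h1 : (p x).head? = some (some !b) <;>
    by_cases h2 : (p y).head? = some (some !c) <;> simp [h1, h2, hzx, hzy, hxz, hyz]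
  · rw [hp.eq_none_cons hzx hxz h1]
  · rw [hp.eq_none_cons hzy hyz h2]

theorem Piled.op {g : RAAG Γ} {p : V → List (Option Bool)} (hp : Piled Γ g p) (x : V) (b : Bool) :
    Piled Γ (letter Γ x b * g) (pileOp Γ x b p) := by
  unfold pileOp
  split_ifs with h
  · obtain ⟨g', p', h1, h2, rfl, rfl⟩ := hp.exists_of_head h
    rw [pilePop_push, letter_not]
    simpa using h1
  · exact hp.push x b h

theorem Piled.op_op {g : RAAG Γ} {p : V → List (Option Bool)} (hp : Piled Γ g p) (x : V)
    (b : Bool) : pileOp Γ x (!b) (pileOp Γ x b p) = p := by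
  by_cases h : (p x).head? = some (some !b)
  · obtain ⟨g', p', h1, h2, rfl, rfl⟩ := hp.exists_of_head h
    have : pileOp Γ x b (pilePush Γ x (!b) p') = p' := by
      rw [pileOp, if_pos h, pilePop_push]
    rw [this, pileOp, if_neg h2]
  · rw [pileOp, pileOp, if_neg h, if_pos (by simp [pilePush]), pilePop_push]

/-- The piles of group elements. -/
abbrev PileSet (Γ : SimpleGraph V) : Type := {p : V → List (Option Bool) // ∃ g, Piled Γ g p}

/-- The permutation of piles induced by a generator. -/
noncomputable def pilePerm (x : V) : Equiv.Perm (PileSet Γ) where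
  toFun p := ⟨pileOp Γ x true p.1, _, p.2.choose_spec.op x true⟩
  invFun p := ⟨pileOp Γ x false p.1, _, p.2.choose_spec.op x false⟩
  left_inv p := Subtype.ext (p.2.choose_spec.op_op x true)
  right_inv p := Subtype.ext (p.2.choose_spec.op_op x false)

/-- The action of the group on piles. -/
noncomputable def pileAct (Γ : SimpleGraph V) : RAAG Γ →* Equiv.Perm (PileSet Γ) :=
  raagLift pilePerm fun _ _ h => Equiv.ext fun p =>
    Subtype.ext (p.2.choose_spec.op_comm h true true)

theorem pileAct_letter (x : V) (b : Bool) (p : PileSet Γ) :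
    (pileAct Γ (letter Γ x b) p).1 = pileOp Γ x b p.1 := by
  cases b
  · simp only [letter_false, map_inv, pileAct]; rfl
  · simp only [letter_true, pileAct]; rfl

/-- The pile of a group element. -/
noncomputable def pile (g : RAAG Γ) : V → List (Option Bool) :=
  (pileAct Γ g ⟨fun _ => [], 1, Piled.one⟩).1

theorem pile_letter_mul (x : V) (b : Bool) (g : RAAG Γ) :
    pile (letter Γ x b * g) = pileOp Γ x b (pile g) := by
  rw [pile, map_mul, Equiv.Perm.mul_apply, pileAct_letter]; rfl

theorem piled_pile (g : RAAG Γ) : Piled Γ g (pile g) := by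
  obtain ⟨l, rfl⟩ := exists_word g
  induction l with
  | nil => simpa [pile] using Piled.one
  | cons x l ih => rw [wordProd_cons, pile_letter_mul]; exact ih.op _ _

theorem Piled.pile_eq {g : RAAG Γ} {p : V → List (Option Bool)} (hp : Piled Γ g p) :
    pile g = p := by
  induction hp with
  | one => simp [pile]
  | push x b _ hx ih => rw [pile_letter_mul, ih, pileOp, if_neg hx]

/-- The half space of all elements having a reduced word that starts with the given letter. -/
def Half (Γ : SimpleGraph V) (v : V) (b : Bool) : Set (RAAG Γ) :=
  {g | (pile g v).head? = some (some b)}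

theorem one_notMem_half (v : V) (b : Bool) : (1 : RAAG Γ) ∉ Half Γ v b := by
  simp [Half, Piled.one.pile_eq]

theorem notMem_half_of_mem {v : V} {b : Bool} {g : RAAG Γ} (h : g ∈ Half Γ v b) :
    g ∉ Half Γ v (!b) := by
  simp only [Half, Set.mem_ofPred_eq] at h ⊢
  simp [h]

theorem head_of_nonadj {v w : V} (hne : v ≠ w) (hadj : ¬Γ.Adj v w) {b : Bool} {g : RAAG Γ}
    (h : g ∈ Half Γ v b) (c : Bool) : g ∉ Half Γ w c := by
  obtain ⟨g', p', h1, h2, h3, h4⟩ := (piled_pile g).exists_of_head h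
  simp [Half, h3, pilePush, hne.symm, hadj]

theorem letter_mul_mem_half_of_adj {v w : V} (h : Γ.Adj w v) (b c : Bool) (g : RAAG Γ) :
    letter Γ w c * g ∈ Half Γ v b ↔ g ∈ Half Γ v b := by
  have hne := h.ne'
  simp only [Half, Set.mem_ofPred_eq, pile_letter_mul]
  unfold pileOp pilePop pilePush
  split_ifs <;> simp [hne, h]

theorem letter_mul_mem_half {v : V} (b : Bool) (g : RAAG Γ) :
    letter Γ v b * g ∈ Half Γ v b ↔ g ∉ Half Γ v (!b) := by
  by_cases hx : (pile g v).head? = some (some !b)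
  · obtain ⟨g', p', h1, h2, h3, h4⟩ := (piled_pile g).exists_of_head hx
    have : pileOp Γ v b (pile g) = p' := by rw [pileOp, if_pos hx, h3, pilePop_push]
    simp only [Half, Set.mem_ofPred_eq, pile_letter_mul, hx, this]
    simpa using h2
  · simp only [Half, Set.mem_ofPred_eq, pile_letter_mul, hx, pileOp, if_false]
    simp [pilePush]

/-- Induction along reduced words. -/
theorem reduced_induction {C : RAAG Γ → Prop} (one : C 1)
    (step : ∀ (x : V) (b : Bool) (g : RAAG Γ), g ∉ Half Γ x (!b) → C g → C (letter Γ x b * g))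
    (g : RAAG Γ) : C g := by
  have : ∀ p, Piled Γ g p → C g := by
    intro p hp
    induction hp with
    | one => exact one
    | push x b hp hx ih =>
      refine step x b _ ?_ ih
      simpa [Half, hp.pile_eq] using hx
  exact this _ (piled_pile g)

theorem exists_mem_half {g : RAAG Γ} (h : g ≠ 1) : ∃ v b, g ∈ Half Γ v b := by
  revert h
  refine reduced_induction (C := fun g => g ≠ 1 → ∃ v b, g ∈ Half Γ v b) (by simp) ?_ g
  intro x b g hg _ _
  exact ⟨x, b, (letter_mul_mem_half b g).2 hg⟩

end Piles

section HalfSpaces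

variable {V : Type} {Γ : SimpleGraph V}

theorem mem_half_not {v : V} {b c : Bool} {g : RAAG Γ} (h : g ∈ Half Γ v c) (hbc : b ≠ c) :
    g ∉ Half Γ v b := by
  have : b = !c := by cases b <;> cases c <;> simp_all
  exact this ▸ notMem_half_of_mem h

theorem letter_mem_half (v : V) (b : Bool) : letter Γ v b ∈ Half Γ v b := by
  simpa using (letter_mul_mem_half b (1 : RAAG Γ)).2 (one_notMem_half v _)

theorem letter_mul_letter_not (v : V) (b : Bool) (g : RAAG Γ) :
    letter Γ v b * (letter Γ v (!b) * g) = g := by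
  rw [letter_not]; group

theorem letter_not_mul_letter (v : V) (b : Bool) (g : RAAG Γ) :
    letter Γ v (!b) * (letter Γ v b * g) = g := by
  rw [letter_not]; group

theorem special_mul_mem_half {v : V} {q : RAAG Γ} (hq : q ∈ special Γ (Γ.neighborSet v))
    (b : Bool) (g : RAAG Γ) : q * g ∈ Half Γ v b ↔ g ∈ Half Γ v b := by
  obtain ⟨l, hl, rfl⟩ := exists_word_of_mem_special hq
  clear hq
  induction l with
  | nil => simp
  | cons x l ih =>
    rw [wordProd_cons, mul_assoc, letter_mul_mem_half_of_adj, ih]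
    · exact fun y hy => hl y (by simp [hy])
    · exact ((Γ.mem_neighborSet v x.1).1 (hl x (by simp))).symm

theorem mul_letter_crossing (g : RAAG Γ) : ∀ v : V,
    (∀ w, w ≠ v → ∀ b c, (g * letter Γ w c ∈ Half Γ v b ↔ g ∈ Half Γ v b)) ∧
    (∀ b c, g ∉ Half Γ v b → g * letter Γ v c ∈ Half Γ v b →
      g ∈ special Γ (Γ.neighborSet v) ∧ c = b) := by
  induction g using reduced_induction with
  | one =>
    intro v
    refine ⟨fun w hwv b c => ?_, fun b c _ h2 => ⟨one_mem _, ?_⟩⟩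
    · rw [one_mul]
      have h1 := one_notMem_half (Γ := Γ) v b
      simp only [h1, iff_false]
      by_cases hadj : Γ.Adj w v
      · have := letter_mul_mem_half_of_adj hadj b c (1 : RAAG Γ)
        rw [mul_one] at this
        rwa [this]
      · exact head_of_nonadj hwv hadj (letter_mem_half w c) b
    · rw [one_mul] at h2
      by_contra hne
      exact mem_half_not h2 hne (letter_mem_half v c)
  | step x η g hg ih =>
    intro v
    have hx : letter Γ x η * g ∈ Half Γ x η := (letter_mul_mem_half η g).2 hg
    refine ⟨fun w hwv b c => ?_, fun b c h1 h2 => ?_⟩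
    · rw [mul_assoc]
      by_cases hadj : Γ.Adj x v
      · rw [letter_mul_mem_half_of_adj hadj, letter_mul_mem_half_of_adj hadj,
          (ih v).1 w hwv b c]
      by_cases hxv : x = v
      · subst hxv
        by_cases hb : b = η
        · subst hb
          rw [letter_mul_mem_half, letter_mul_mem_half, (ih x).1 w hwv]
        · have h2 : letter Γ x η * (g * letter Γ w c) ∈ Half Γ x η := by
            rw [letter_mul_mem_half, (ih x).1 w hwv]; exact hg
          simp only [mem_half_not hx hb, mem_half_not h2 hb]
      · have h1 : letter Γ x η * g ∉ Half Γ v b := head_of_nonadj hxv hadj hx b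
        simp only [h1, iff_false]
        by_cases hxw : x = w
        · subst hxw
          by_cases h3 : g * letter Γ x c ∈ Half Γ x (!η)
          · obtain ⟨h4, rfl⟩ := (ih x).2 _ _ hg h3
            have h5 : ∀ b, Commute (letter Γ x b) g := fun b =>
              commute_of_mem_special (Set.subset_insert _ _) h4 b
            rw [← (h5 _).eq, letter_mul_letter_not]
            rw [(h5 _).eq, (ih v).1 x hxv] at h1
            exact h1
          · exact head_of_nonadj hxv hadj ((letter_mul_mem_half η _).2 h3) b
        · refine head_of_nonadj hxv hadj (b := η) ?_ b
          rw [letter_mul_mem_half, (ih x).1 w (Ne.symm hxw)]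
          exact hg
    · rw [mul_assoc] at h2
      by_cases hadj : Γ.Adj x v
      · rw [letter_mul_mem_half_of_adj hadj] at h1 h2
        obtain ⟨h3, h4⟩ := (ih v).2 b c h1 h2
        exact ⟨mul_mem (letter_mem_special hadj.symm _) h3, h4⟩
      exfalso
      by_cases hxv : x = v
      · subst hxv
        have hb : η = !b := by
          cases b <;> cases η <;> first | rfl | exact absurd hx h1
        subst hb
        have h3 := notMem_half_of_mem h2
        rw [letter_mul_mem_half, not_not, Bool.not_not] at h3
        rw [Bool.not_not] at hg
        obtain ⟨h4, rfl⟩ := (ih x).2 b c hg h3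
        rw [← (commute_of_mem_special (Set.subset_insert _ _) h4 _).eq,
          letter_not_mul_letter] at h2
        exact hg h2
      · refine head_of_nonadj hxv hadj (b := η) ?_ b h2
        rw [letter_mul_mem_half, (ih x).1 v (Ne.symm hxv)]
        exact hg

theorem mul_letter_mem_half {v w : V} (h : w ≠ v) (b c : Bool) (g : RAAG Γ) :
    g * letter Γ w c ∈ Half Γ v b ↔ g ∈ Half Γ v b :=
  (mul_letter_crossing g v).1 w h b c

/-- An edge crossing the boundary of a half space is parallel to the defining one. -/
theorem mem_special_of_crossing {v w : V} {b c : Bool} {g : RAAG Γ} (h1 : g ∉ Half Γ v b)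
    (h2 : g * letter Γ w c ∈ Half Γ v b) :
    w = v ∧ c = b ∧ g ∈ special Γ (Γ.neighborSet v) := by
  by_cases hw : w = v
  · subst hw
    obtain ⟨h3, h4⟩ := (mul_letter_crossing g w).2 b c h1 h2
    exact ⟨rfl, h4, h3⟩
  · exact absurd ((mul_letter_mem_half hw b c g).1 h2) h1

theorem exists_crossing {v : V} {b : Bool} (l : List (V × Bool)) {y : RAAG Γ}
    (h1 : y ∉ Half Γ v b) (h2 : y * wordProd Γ l ∈ Half Γ v b) :
    ∃ l₁ l₂, l = l₁ ++ (v, b) :: l₂ ∧ y * wordProd Γ l₁ ∈ special Γ (Γ.neighborSet v) := by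
  induction l generalizing y with
  | nil => simp [h1] at h2
  | cons x l ih =>
    by_cases h3 : y * letter Γ x.1 x.2 ∈ Half Γ v b
    · obtain ⟨e1, e2, h4⟩ := mem_special_of_crossing h1 h3
      exact ⟨[], l, by simp [← e1, ← e2], by simpa using h4⟩
    · rw [wordProd_cons, ← mul_assoc] at h2
      obtain ⟨l₁, l₂, rfl, h4⟩ := ih h3 h2
      exact ⟨x :: l₁, l₂, by simp, by simpa [mul_assoc] using h4⟩

theorem exists_crossing_special {v : V} {b : Bool} {S : Set V} {y c : RAAG Γ}
    (hc : c ∈ special Γ S) (h1 : y ∉ Half Γ v b) (h2 : y * c ∈ Half Γ v b) :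
    v ∈ S ∧ ∃ c₁ ∈ special Γ S, y * c₁ ∈ special Γ (Γ.neighborSet v) := by
  obtain ⟨l, hl, rfl⟩ := exists_word_of_mem_special hc
  obtain ⟨l₁, l₂, rfl, h3⟩ := exists_crossing l h1 h2
  exact ⟨hl (v, b) (by simp), wordProd Γ l₁,
    wordProd_mem_special fun x hx => hl x (by simp [hx]), h3⟩

theorem mul_special_mem_half {v : V} {S : Set V} (hv : v ∉ S) {c : RAAG Γ}
    (hc : c ∈ special Γ S) (b : Bool) (y : RAAG Γ) :
    y * c ∈ Half Γ v b ↔ y ∈ Half Γ v b := by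
  by_contra hne
  by_cases h : y ∈ Half Γ v b
  · have h' : y * c ∉ Half Γ v b := fun h' => hne ⟨fun _ => h, fun _ => h'⟩
    exact hv (exists_crossing_special (inv_mem hc) h' (by simpa using h)).1
  · have h' : y * c ∈ Half Γ v b := by
      by_contra h'
      exact hne ⟨fun h'' => absurd h'' h', fun h'' => absurd h'' h⟩
    exact hv (exists_crossing_special hc h h').1

theorem len_reflect_lt {v : V} {b : Bool} {k h : RAAG Γ} (h1 : k⁻¹ ∉ Half Γ v b)
    (h2 : k⁻¹ * h ∈ Half Γ v b) : len (k * letter Γ v (!b) * k⁻¹ * h) < len h := by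
  obtain ⟨l, rfl, hl⟩ := exists_word_len h
  obtain ⟨l₁, l₂, rfl, h3⟩ := exists_crossing l h1 h2
  have h4 := commute_of_mem_special (Set.subset_insert _ _) h3 (!b)
  have : k * letter Γ v (!b) * k⁻¹ * wordProd Γ (l₁ ++ (v, b) :: l₂) = wordProd Γ (l₁ ++ l₂) := by
    calc _ = k * (letter Γ v (!b) * (k⁻¹ * wordProd Γ l₁)) *
          (letter Γ v b * wordProd Γ l₂) := by simp [mul_assoc]
      _ = _ := by
        rw [h4.eq, mul_assoc, mul_assoc, letter_not_mul_letter, mul_assoc]; simp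
  rw [this, ← hl]
  refine (len_le _).trans_lt ?_
  simp

theorem len_letter_mul_lt {v : V} {b : Bool} {h : RAAG Γ} (h2 : h ∈ Half Γ v b) :
    len (letter Γ v (!b) * h) < len h := by
  have := len_reflect_lt (k := 1) (h := h) (v := v) (b := b)
    (by simpa using one_notMem_half v b) (by simpa using h2)
  simpa using this

/-- Half spaces of non-adjacent vertices do not cross. -/
theorem half_disjoint {v w : V} (hne : v ≠ w) (hadj : ¬Γ.Adj v w) {b c : Bool} {k h : RAAG Γ}
    (h1 : k ∉ Half Γ v b) (h2 : k⁻¹ ∉ Half Γ w c) (h3 : h ∈ Half Γ v b) :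
    k⁻¹ * h ∉ Half Γ w c := by
  obtain ⟨l, rfl⟩ := exists_word h
  induction l using List.reverseRecOn with
  | nil => exact absurd h3 (one_notMem_half v b)
  | append_singleton l z ih =>
    have hz : wordProd Γ (l ++ [z]) = wordProd Γ l * letter Γ z.1 z.2 := by simp
    rw [hz] at h3 ⊢
    intro h4
    by_cases h5 : wordProd Γ l ∈ Half Γ v b
    · have h6 := ih h5
      rw [← mul_assoc] at h4
      obtain ⟨e, -, h7⟩ := mem_special_of_crossing h6 h4
      apply h1
      have := mul_special_mem_half (v := v) (fun h => hadj ((Γ.mem_neighborSet w v).1 h).symm)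
        (inv_mem h7) b (wordProd Γ l)
      rw [← this] at h5
      simpa using h5
    · obtain ⟨e, -, h7⟩ := mem_special_of_crossing h5 h3
      rw [e, ← mul_assoc, mul_letter_mem_half hne,
        mul_special_mem_half (v := w) (fun h => hadj ((Γ.mem_neighborSet v w).1 h)) h7] at h4
      exact h2 h4

/-- Centralizers of a generator times an element supported on its link. -/
theorem mem_special_star_of_commute {w : V} {q : RAAG Γ}
    (hq : q ∈ special Γ (Γ.neighborSet w)) {h : RAAG Γ}
    (hc : Commute h (raagGen Γ w * q)) : h ∈ special Γ (Gstar Γ w) := by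
  have hsub : special Γ (Γ.neighborSet w) ≤ special Γ (Gstar Γ w) :=
    special_mono (Set.subset_insert _ _)
  have hp : raagGen Γ w * q ∈ special Γ (Gstar Γ w) :=
    mul_mem (letter_mem_special (Set.mem_insert _ _) true) (hsub hq)
  induction hn : len h using Nat.strong_induction_on generalizing h with
  | _ n ih =>
    by_cases hb : ∃ b, h ∈ Half Γ w b
    · obtain ⟨b, hb⟩ := hb
      have h1 := ih _ (hn ▸ len_letter_mul_lt hb)
        ((commute_of_mem_special subset_rfl hp (!b)).mul_left hc) rfl
      have := mul_mem (letter_mem_special (Γ := Γ) (Set.mem_insert w (Γ.neighborSet w)) b) h1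
      rwa [letter_mul_letter_not] at this
    · push Not at hb
      have h1 : h * (raagGen Γ w * q) ∈ Half Γ w true := by
        rw [hc.eq, mul_assoc, ← letter_true, letter_mul_mem_half, special_mul_mem_half hq]
        exact hb _
      obtain ⟨-, c, hc1, hc2⟩ := exists_crossing_special hp (hb true) h1
      simpa using mul_mem (hsub hc2) (inv_mem hc1)

theorem mem_special_star_of_commute_gen {w : V} {h : RAAG Γ} (hc : Commute h (raagGen Γ w)) :
    h ∈ special Γ (Gstar Γ w) :=
  mem_special_star_of_commute (one_mem _) (by simpa using hc)

theorem exists_star_mul_star {v w : V} {k : RAAG Γ}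
    (hc : Commute (raagGen Γ v) (k * raagGen Γ w * k⁻¹)) :
    ∃ s ∈ special Γ (Gstar Γ v), ∃ t ∈ special Γ (Gstar Γ w), k = s * t := by
  induction hn : len k using Nat.strong_induction_on generalizing k with
  | _ n ih =>
    by_cases hb : ∃ b, k ∈ Half Γ v b
    · obtain ⟨b, hb⟩ := hb
      have h0 : Commute (raagGen Γ v)
          (letter Γ v (!b) * k * raagGen Γ w * (letter Γ v (!b) * k)⁻¹) := by
        have h1 : Commute (raagGen Γ v) (letter Γ v (!b)) := by cases b <;> simp
        have := (h1.mul_right hc).mul_right h1.inv_right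
        simpa [mul_assoc] using this
      obtain ⟨s, hs, t, ht, e⟩ := ih _ (hn ▸ len_letter_mul_lt hb) h0 rfl
      refine ⟨letter Γ v b * s, mul_mem (letter_mem_special (Set.mem_insert _ _) b) hs, t, ht, ?_⟩
      rw [mul_assoc, ← e, letter_mul_letter_not]
    · push Not at hb
      have h0 : Commute (k⁻¹ * raagGen Γ v * k) (raagGen Γ w) := by
        have := congrArg (fun x => k⁻¹ * x * k) hc.eq
        simp only [mul_assoc, inv_mul_cancel_left, inv_mul_cancel, mul_one] at this
        rw [Commute, SemiconjBy]
        simpa [mul_assoc] using this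
      have h1 := mem_special_star_of_commute_gen h0
      have h2 : k * (k⁻¹ * raagGen Γ v * k) ∈ Half Γ v true := by
        have : k * (k⁻¹ * raagGen Γ v * k) = letter Γ v true * k := by simp [mul_assoc]
        rw [this, letter_mul_mem_half]
        exact hb _
      obtain ⟨-, c, hc1, hc2⟩ := exists_crossing_special h1 (hb true) h2
      exact ⟨k * c, special_mono (Set.subset_insert _ _) hc2, c⁻¹, inv_mem hc1, by simp⟩

end HalfSpaces

section Components

variable {V : Type} {Γ : SimpleGraph V} {S K : Set V}

theorem _root_.IsCompOf.subset (h : IsCompOf Γ S K) : K ⊆ S := by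
  obtain ⟨c, rfl⟩ := h
  rintro _ ⟨x, -, rfl⟩
  exact x.2

theorem _root_.IsCompOf.nonempty (h : IsCompOf Γ S K) : K.Nonempty := by
  obtain ⟨c, rfl⟩ := h
  exact c.nonempty_supp.image _

theorem _root_.IsCompOf.mem_of_adj (h : IsCompOf Γ S K) {v w : V} (hv : v ∈ K) (hw : w ∈ S)
    (ha : Γ.Adj v w) : w ∈ K := by
  obtain ⟨c, rfl⟩ := h
  obtain ⟨x, hx, rfl⟩ := hv
  refine ⟨⟨w, hw⟩, ?_, rfl⟩
  rw [ConnectedComponent.mem_supp_iff] at hx ⊢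
  rw [← hx, ConnectedComponent.eq]
  exact (Adj.reachable (G := Γ.induce S) (by simpa using ha)).symm

theorem exists_isCompOf {v : V} (hv : v ∈ S) : ∃ K, IsCompOf Γ S K ∧ v ∈ K :=
  ⟨_, ⟨(Γ.induce S).connectedComponentMk ⟨v, hv⟩, rfl⟩, ⟨v, hv⟩, rfl, rfl⟩

/-- A subset of a component that meets it and is closed under adjacency is everything. -/
theorem _root_.IsCompOf.subset_of_closed (h : IsCompOf Γ S K) {T : Set V} {v : V} (hv : v ∈ K)
    (hvT : v ∈ T) (hT : ∀ x ∈ T, x ∈ K → ∀ y ∈ K, Γ.Adj x y → y ∈ T) : K ⊆ T := by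
  have hc := h
  obtain ⟨c, rfl⟩ := h
  obtain ⟨v, hvc, rfl⟩ := hv
  rintro _ ⟨w, hw, rfl⟩
  have hr : (Γ.induce S).Reachable v w := by
    rw [ConnectedComponent.mem_supp_iff] at hvc hw
    rw [← ConnectedComponent.eq, hvc, hw]
  obtain ⟨p⟩ := hr
  induction p with
  | nil => exact hvT
  | @cons x y z hxy p ih =>
    have hxy' : Γ.Adj x.1 y.1 := by simpa using hxy
    have hx : x.1 ∈ Subtype.val '' c.supp := ⟨x, hvc, rfl⟩
    have hy : y.1 ∈ Subtype.val '' c.supp := IsCompOf.mem_of_adj hc hx y.2 hxy'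
    have hyc : y ∈ c.supp := by simpa using hy
    exact ih hyc (hT _ hvT hx _ hy hxy') hw

theorem _root_.IsCompOf.eq_of_mem {L : Set V} (hK : IsCompOf Γ S K) (hL : IsCompOf Γ S L) {v : V}
    (h1 : v ∈ K) (h2 : v ∈ L) : K = L := by
  apply Set.Subset.antisymm
  · exact IsCompOf.subset_of_closed hK h1 h2 fun x hx _ y hy ha =>
      IsCompOf.mem_of_adj hL hx (IsCompOf.subset hK hy) ha
  · exact IsCompOf.subset_of_closed hL h2 h1 fun x hx _ y hy ha =>
      IsCompOf.mem_of_adj hK hx (IsCompOf.subset hL hy) ha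

end Components

section PartialConj

open scoped Classical

variable {V : Type} {Γ : SimpleGraph V}

/-- The condition on `K` under which conjugating the vertices of `K` by `a` is well defined. -/
def IsPCDomain (Γ : SimpleGraph V) (a : V) (K : Set V) : Prop :=
  ∀ v ∈ K, ∀ w ∉ K, Γ.Adj v w → w ∈ Gstar Γ a

theorem _root_.IsCompOf.isDomain {a : V} {K : Set V} (h : IsCompOf Γ (Gstar Γ a)ᶜ K) :
    IsPCDomain Γ a K := fun v hv w hw ha => by
  by_contra hn
  exact hw (IsCompOf.mem_of_adj h hv hn ha)

/-- The endomorphism conjugating the vertices of `K` by the given letter. -/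
noncomputable def pcHom {a : V} {K : Set V} (h : IsPCDomain Γ a K) (b : Bool) :
    RAAG Γ →* RAAG Γ :=
  raagLift (fun v => if v ∈ K then letter Γ a b * raagGen Γ v * (letter Γ a b)⁻¹
    else raagGen Γ v) (by
    have key : ∀ v w, Γ.Adj v w → v ∈ K → w ∉ K →
        Commute (letter Γ a b * raagGen Γ v * (letter Γ a b)⁻¹) (raagGen Γ w) := by
      intro v w hvw hv hw
      have h1 : Commute (letter Γ a b) (raagGen Γ w) := by
        rcases h v hv w hw hvw with rfl | h2
        · cases b <;> simp
        · exact letter_commute h2 b true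
      exact (h1.mul_left (gen_commute hvw)).mul_left h1.inv_left
    intro v w hvw
    by_cases hv : v ∈ K <;> by_cases hw : w ∈ K <;> simp only [hv, hw, if_true, if_false]
    · have := (gen_commute hvw).map (MulAut.conj (letter Γ a b)).toMonoidHom
      simpa using this
    · exact key v w hvw hv hw
    · exact (key w v hvw.symm hw hv).symm
    · exact gen_commute hvw)

theorem pcHom_gen {a : V} {K : Set V} (h : IsPCDomain Γ a K) (b : Bool) (v : V) :
    pcHom h b (raagGen Γ v) = if v ∈ K then letter Γ a b * raagGen Γ v * (letter Γ a b)⁻¹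
      else raagGen Γ v :=
  raagLift_gen _ _ _

theorem pcHom_self {a : V} {K : Set V} (h : IsPCDomain Γ a K) (b c : Bool) :
    pcHom h b (letter Γ a c) = letter Γ a c := by
  have : pcHom h b (raagGen Γ a) = raagGen Γ a := by
    rw [pcHom_gen]
    split_ifs
    · cases b <;> simp
    · rfl
  cases c <;> simp [this]

theorem pcHom_comp {a : V} {K : Set V} (h : IsPCDomain Γ a K) (b : Bool) (g : RAAG Γ) :
    pcHom h b (pcHom h (!b) g) = g := by
  suffices (pcHom h b).comp (pcHom h (!b)) = MonoidHom.id _ from DFunLike.congr_fun this g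
  apply raag_hom_ext
  intro v
  simp only [MonoidHom.comp_apply, MonoidHom.id_apply]
  rw [pcHom_gen]
  split_ifs with hv
  · rw [map_mul, map_mul, map_inv, pcHom_self, pcHom_gen, if_pos hv, letter_not]
    group
  · rw [pcHom_gen, if_neg hv]

/-- The automorphism conjugating the vertices of `K` by the given letter. -/
noncomputable def pconj {a : V} {K : Set V} (h : IsPCDomain Γ a K) (b : Bool) :
    MulAut (RAAG Γ) where
  toFun := pcHom h b
  invFun := pcHom h (!b)
  left_inv g := by simpa only [Bool.not_not] using pcHom_comp h (!b) g
  right_inv g := pcHom_comp h b g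
  map_mul' := map_mul _

theorem pconj_gen {a : V} {K : Set V} (h : IsPCDomain Γ a K) (b : Bool) (v : V) :
    pconj h b (raagGen Γ v) = if v ∈ K then letter Γ a b * raagGen Γ v * (letter Γ a b)⁻¹
      else raagGen Γ v :=
  pcHom_gen h b v

theorem pconj_not {a : V} {K : Set V} (h : IsPCDomain Γ a K) (b : Bool) :
    pconj h (!b) = (pconj h b)⁻¹ := by
  rw [eq_inv_iff_mul_eq_one]
  refine MulEquiv.ext fun g => ?_
  have := pcHom_comp h (!b) g
  rw [Bool.not_not] at this
  exact this

theorem mulAut_ext {φ ψ : MulAut (RAAG Γ)}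
    (h : ∀ v, φ (raagGen Γ v) = ψ (raagGen Γ v)) : φ = ψ := by
  have : φ.toMonoidHom = ψ.toMonoidHom := raag_hom_ext h
  exact MulEquiv.ext fun g => DFunLike.congr_fun this g

theorem mem_PSA_iff {φ : MulAut (RAAG Γ)} :
    φ ∈ PSA Γ ↔ ∀ v, ∃ g, φ (raagGen Γ v) = g * raagGen Γ v * g⁻¹ := by
  change (∀ v, IsConj _ _) ↔ _
  simp only [isConj_iff]
  exact forall_congr' fun v => exists_congr fun g => eq_comm

theorem pconj_mem_PSA {a : V} {K : Set V} (h : IsPCDomain Γ a K) (b : Bool) :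
    pconj h b ∈ PSA Γ := by
  rw [mem_PSA_iff]
  intro v
  rw [pconj_gen]
  split_ifs
  · exact ⟨_, rfl⟩
  · exact ⟨1, by simp⟩

end PartialConj

section Generation

variable {V : Type} {Γ : SimpleGraph V}

theorem special_star_conj {v : V} {s x : RAAG Γ} (hs : s ∈ special Γ (Gstar Γ v))
    (hx : x ∈ special Γ (Γ.neighborSet v)) : s * x * s⁻¹ ∈ special Γ (Γ.neighborSet v) := by
  obtain ⟨l, hl, rfl⟩ := exists_word_of_mem_special hs
  clear hs
  induction l with
  | nil => simpa using hx
  | cons y l ih =>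
    have h1 := ih fun z hz => hl z (by simp [hz])
    have e : wordProd Γ (y :: l) * x * (wordProd Γ (y :: l))⁻¹ =
        letter Γ y.1 y.2 * (wordProd Γ l * x * (wordProd Γ l)⁻¹) * (letter Γ y.1 y.2)⁻¹ := by
      simp [mul_assoc]
    rw [e]
    rcases hl y (by simp) with h2 | h2
    · rw [h2, (commute_of_mem_special (Set.subset_insert _ _) h1 y.2).eq, mul_inv_cancel_right]
      exact h1
    · exact mul_mem (mul_mem (letter_mem_special h2 _) h1) (inv_mem (letter_mem_special h2 _))

theorem map_letter {φ : MulAut (RAAG Γ)} {v : V} {g : RAAG Γ}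
    (h : φ (raagGen Γ v) = g * raagGen Γ v * g⁻¹) (b : Bool) :
    φ (letter Γ v b) = g * letter Γ v b * g⁻¹ := by
  cases b
  · simp [h, mul_assoc]
  · simpa using h

theorem exists_common_conj {φ : MulAut (RAAG Γ)} {v w : V} {g h : RAAG Γ} (hvw : Γ.Adj v w)
    (hg : φ (raagGen Γ v) = g * raagGen Γ v * g⁻¹)
    (hh : φ (raagGen Γ w) = h * raagGen Γ w * h⁻¹) :
    ∃ s ∈ special Γ (Gstar Γ v), ∃ t ∈ special Γ (Gstar Γ w), g⁻¹ * h = s * t := by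
  apply exists_star_mul_star
  have h1 := (gen_commute hvw).map φ.toMonoidHom
  have h2 := h1.map (MulAut.conj g⁻¹).toMonoidHom
  simpa [hg, hh, mul_assoc] using h2

theorem eq_of_letter_eq_conj {v w : V} {b c : Bool} {g : RAAG Γ}
    (h : letter Γ v b = g * letter Γ w c * g⁻¹) : v = w ∧ b = c := by
  classical
  let f : RAAG Γ →* Multiplicative ℤ :=
    raagLift (fun x => Multiplicative.ofAdd (if x = v then 1 else 0)) fun _ _ _ => Commute.all _ _
  have h1 := congrArg (fun x => (f x).toAdd) h
  have hf : ∀ x, f (raagGen Γ x) = Multiplicative.ofAdd (if x = v then 1 else 0) := fun x =>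
    raagLift_gen _ _ _
  have h2 : ∀ x d, (f (letter Γ x d)).toAdd = if x = v then (if d then 1 else -1) else 0 := by
    intro x d
    cases d <;> by_cases hx : x = v <;> simp [hf, hx]
  simp only [map_mul, map_inv, mul_comm (f g), mul_inv_cancel_right, h2] at h1
  by_cases hw : w = v
  · cases b <;> cases c <;> simp [hw] at h1 ⊢
  · cases b <;> simp [hw] at h1

/-- A pure symmetric automorphism none of whose conjugators can be shortened is trivial. -/
theorem eq_one_of_no_shortening {φ : MulAut (RAAG Γ)} {g : V → RAAG Γ}
    (hφ : ∀ v, φ (raagGen Γ v) = g v * raagGen Γ v * (g v)⁻¹)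
    (h1 : ∀ v b, (g v)⁻¹ ∉ Half Γ v b)
    (h2 : ∀ v w b, w ∉ Gstar Γ v → (g v)⁻¹ * g w ∉ Half Γ v b) : φ = 1 := by
  have key : ∀ u v b, (g v)⁻¹ * φ u ∈ Half Γ v b ↔ u ∈ Half Γ v b := by
    intro u
    induction u using reduced_induction with
    | one =>
      intro v b
      simp [h1, one_notMem_half]
    | step x c u hu ih =>
      intro v b
      have hx : letter Γ x c * u ∈ Half Γ x c := (letter_mul_mem_half c u).2 hu
      have hx' : (g x)⁻¹ * φ (letter Γ x c * u) ∈ Half Γ x c := by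
        have e : (g x)⁻¹ * φ (letter Γ x c * u) = letter Γ x c * ((g x)⁻¹ * φ u) := by
          rw [map_mul, map_letter (hφ x)]; group
        rw [e, letter_mul_mem_half, ih]
        exact hu
      by_cases hxv : x = v
      · subst hxv
        by_cases hbc : b = c
        · subst hbc; simp only [hx, hx']
        · simp only [mem_half_not hx hbc, mem_half_not hx' hbc]
      by_cases hadj : Γ.Adj x v
      · rw [letter_mul_mem_half_of_adj hadj, ← ih v b]
        obtain ⟨s, hs, t, ht, e⟩ := exists_common_conj hadj.symm (hφ v) (hφ x)
        have h3 := commute_of_mem_special subset_rfl ht c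
        have e2 : (g v)⁻¹ * φ (letter Γ x c * u) =
            (s * letter Γ x c * s⁻¹) * ((g v)⁻¹ * φ u) := by
          have e3 : g x = g v * (s * t) := by rw [← e]; group
          calc _ = s * (t * letter Γ x c) * t⁻¹ * s⁻¹ * ((g v)⁻¹ * φ u) := by
                rw [map_mul, map_letter (hφ x), e3]; group
            _ = _ := by rw [← h3.eq]; group
        rw [e2, special_mul_mem_half]
        exact special_star_conj hs (letter_mem_special hadj.symm c)
      · have hn : x ∉ Gstar Γ v := by
          rintro (h | h)
          exacts [hxv h, hadj (SimpleGraph.Adj.symm h)]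
        have hn' : v ∉ Gstar Γ x := by
          rintro (h | h)
          exacts [hxv h.symm, hadj h]
        have h3 : letter Γ x c * u ∉ Half Γ v b := head_of_nonadj hxv hadj hx b
        simp only [h3, iff_false]
        have := half_disjoint (k := (g x)⁻¹ * g v) hxv hadj (c := b) (h2 x v c hn')
          (by simpa using h2 v x b hn) hx'
        simpa [mul_assoc] using this
  apply mulAut_ext
  intro x
  obtain ⟨u, hu⟩ := φ.surjective (raagGen Γ x)
  have hu1 : u ≠ 1 := by
    rintro rfl
    have := letter_mem_half (Γ := Γ) x true
    rw [letter_true, ← hu, map_one] at this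
    exact one_notMem_half _ _ this
  obtain ⟨v, b, hvb⟩ := exists_mem_half hu1
  have h3 := (key u v b).2 hvb
  rw [hu] at h3
  have h4 := len_reflect_lt (h1 v b) h3
  have h5 : len (raagGen Γ x) ≤ 1 := by simpa using len_le (Γ := Γ) [(x, true)]
  have h6 := eq_one_of_len_eq_zero (by omega :
    len (g v * letter Γ v (!b) * (g v)⁻¹ * raagGen Γ x) = 0)
  rw [← map_letter (hφ v), letter_not, map_inv, inv_mul_eq_one] at h6
  rw [map_letter (hφ v)] at h6
  obtain ⟨rfl, rfl⟩ := eq_of_letter_eq_conj (b := true) h6.symm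
  rw [MulAut.one_apply, hφ]
  simpa using h6

/-- The length of a shortest conjugator for the image of `v`. -/
noncomputable def conjLen (φ : MulAut (RAAG Γ)) (v : V) : ℕ :=
  sInf {n | ∃ g, φ (raagGen Γ v) = g * raagGen Γ v * g⁻¹ ∧ len g = n}

theorem conjLen_le {φ : MulAut (RAAG Γ)} {v : V} {g : RAAG Γ}
    (h : φ (raagGen Γ v) = g * raagGen Γ v * g⁻¹) : conjLen φ v ≤ len g :=
  Nat.sInf_le ⟨g, h, rfl⟩

theorem exists_conjLen {φ : MulAut (RAAG Γ)} (hφ : φ ∈ PSA Γ) (v : V) :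
    ∃ g, φ (raagGen Γ v) = g * raagGen Γ v * g⁻¹ ∧ len g = conjLen φ v := by
  obtain ⟨g, hg⟩ := mem_PSA_iff.1 hφ v
  exact Nat.sInf_mem (s := {n | ∃ g, φ (raagGen Γ v) = g * raagGen Γ v * g⁻¹ ∧ len g = n})
    ⟨_, g, hg, rfl⟩

/-- The partial conjugations generate the pure symmetric automorphism group. -/
theorem mem_closure_pconj [Fintype V] {φ : MulAut (RAAG Γ)} (hφ : φ ∈ PSA Γ) :
    φ ∈ Subgroup.closure {ψ | ∃ (a : V) (K : Set V) (h : IsCompOf Γ (Gstar Γ a)ᶜ K),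
      ψ = pconj (IsCompOf.isDomain h) true} := by
  classical
  induction hn : ∑ v, conjLen φ v using Nat.strong_induction_on generalizing φ with
  | _ n ih =>
    choose g hg hlen using exists_conjLen hφ
    have h1 : ∀ v b, (g v)⁻¹ ∉ Half Γ v b := by
      intro v b hb
      have h2 := len_letter_mul_lt hb
      rw [len_inv, ← len_inv] at h2
      have h3 : φ (raagGen Γ v) = (letter Γ v (!b) * (g v)⁻¹)⁻¹ * raagGen Γ v *
          ((letter Γ v (!b) * (g v)⁻¹)⁻¹)⁻¹ := by
        rw [hg]; cases b <;> simp [mul_assoc]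
      have h4 := conjLen_le h3
      rw [← hlen] at h4
      omega
    by_cases h2 : ∀ v w b, w ∉ Gstar Γ v → (g v)⁻¹ * g w ∉ Half Γ v b
    · rw [eq_one_of_no_shortening hg h1 h2]
      exact one_mem _
    · push Not at h2
      obtain ⟨v, w, b, hw, hwb⟩ := h2
      obtain ⟨K, hK, hwK⟩ := exists_isCompOf (Γ := Γ) (S := (Gstar Γ v)ᶜ) hw
      have hKhalf : K ⊆ {x | (g v)⁻¹ * g x ∈ Half Γ v b} := by
        refine IsCompOf.subset_of_closed hK hwK hwb fun x hx hxK y hyK hxy => ?_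
        obtain ⟨s, hs, t, ht, e⟩ := exists_common_conj hxy (hg x) (hg y)
        have hnot : ∀ z ∈ K, v ∉ Gstar Γ z := by
          intro z hz h
          apply IsCompOf.subset hK hz
          rcases h with h | h
          · exact h ▸ Set.mem_insert _ _
          · exact Set.mem_insert_of_mem _ (SimpleGraph.Adj.symm h)
        have e3 : (g v)⁻¹ * g y = (g v)⁻¹ * g x * s * t := by
          rw [mul_assoc _ s t, ← e]; group
        rw [Set.mem_ofPred_eq, e3, mul_special_mem_half (hnot y hyK) ht,
          mul_special_mem_half (hnot x hxK) hs]
        exact hx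
      have hψg : ∀ x ∈ K, (φ * pconj (IsCompOf.isDomain hK) (!b)) (raagGen Γ x) =
          (g v * letter Γ v (!b) * (g v)⁻¹ * g x) * raagGen Γ x *
          (g v * letter Γ v (!b) * (g v)⁻¹ * g x)⁻¹ := by
        intro x hx
        rw [MulAut.mul_apply, pconj_gen, if_pos hx, map_mul, map_mul, map_inv,
          map_letter (hg v), hg x]
        group
      have hψg' : ∀ x ∉ K, (φ * pconj (IsCompOf.isDomain hK) (!b)) (raagGen Γ x) =
          φ (raagGen Γ x) := by
        intro x hx
        rw [MulAut.mul_apply, pconj_gen, if_neg hx]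
      have hlt : ∀ x ∈ K, conjLen (φ * pconj (IsCompOf.isDomain hK) (!b)) x < conjLen φ x := by
        intro x hx
        rw [← hlen]
        exact (conjLen_le (hψg x hx)).trans_lt (len_reflect_lt (h1 v b) (hKhalf hx))
      have hsum : ∑ x, conjLen (φ * pconj (IsCompOf.isDomain hK) (!b)) x < n := by
        rw [← hn]
        refine Finset.sum_lt_sum (fun x _ => ?_) ⟨w, Finset.mem_univ _, hlt w hwK⟩
        by_cases hx : x ∈ K
        · exact (hlt x hx).le
        · simp only [conjLen, hψg' x hx, le_refl]
      have h5 := ih _ hsum (mul_mem hφ (pconj_mem_PSA _ _)) rfl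
      have h6 : pconj (IsCompOf.isDomain hK) true ∈
          Subgroup.closure {ψ | ∃ (a : V) (K : Set V) (h : IsCompOf Γ (Gstar Γ a)ᶜ K),
            ψ = pconj (IsCompOf.isDomain h) true} :=
        Subgroup.subset_closure ⟨v, K, hK, rfl⟩
      have h7 : pconj (IsCompOf.isDomain hK) (!b) ∈
          Subgroup.closure {ψ | ∃ (a : V) (K : Set V) (h : IsCompOf Γ (Gstar Γ a)ᶜ K),
            ψ = pconj (IsCompOf.isDomain h) true} := by
        cases b
        · exact h6
        · rw [pconj_not]; exact inv_mem h6
      simpa using mul_mem h5 (inv_mem h7)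

end Generation

section NoSIL

open scoped Classical

variable {V : Type} {Γ : SimpleGraph V}

theorem subset_or_disjoint_of_no_sil (hsil : ¬HasSIL Γ) {a b : V} (hab : a ≠ b)
    (hadj : ¬Γ.Adj a b) {K L : Set V} (hK : IsCompOf Γ (Gstar Γ a)ᶜ K)
    (hL : IsCompOf Γ (Gstar Γ b)ᶜ L) (haL : a ∉ L) :
    (b ∈ K → L ⊆ K) ∧ (b ∉ K → Disjoint L K) := by
  have hLa : ∀ l ∈ L, l ∉ Gstar Γ a := by
    rintro l hl (rfl | h)
    · exact haL hl
    · refine haL (IsCompOf.mem_of_adj hL hl ?_ (SimpleGraph.Adj.symm h))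
      rintro (h' | h')
      exacts [hab h', hadj (SimpleGraph.Adj.symm h')]
  have hLb : ∀ l ∈ L, l ∉ Gstar Γ b := fun l hl => IsCompOf.subset hL hl
  have hbL : b ∉ L := fun h => hLb b h (Set.mem_insert _ _)
  have hbstar : b ∉ Gstar Γ a := by
    rintro (h | h)
    exacts [hab h.symm, hadj h]
  have hsub : ∀ l ∈ L, l ∈ K → L ⊆ K := fun l hl hlK =>
    IsCompOf.subset_of_closed hL hl hlK fun x _ hxK y hy hxy =>
      IsCompOf.mem_of_adj hK ‹_› (hLa y hy) hxy
  have hex : ∃ l ∈ L, ∃ n ∉ L, n ∉ Gstar Γ a ∧ Γ.Adj l n := by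
    by_contra! hno
    apply hsil
    have hlk : ∀ l ∈ L, ∀ n ∉ L, Γ.Adj l n → n ∈ Γ.neighborSet a ∩ Γ.neighborSet b := by
      intro l hl n hn hln
      have h1 : n ∈ Gstar Γ a := by
        by_contra h
        exact hno l hl n hn h hln
      have h2 : n ∈ Gstar Γ b := by
        by_contra h
        exact hn (IsCompOf.mem_of_adj hL hl h hln)
      constructor
      · rcases h1 with rfl | h1
        · exact absurd (Or.inr (SimpleGraph.Adj.symm hln)) (hLa l hl)
        · exact h1
      · rcases h2 with rfl | h2
        · exact absurd (Or.inr (SimpleGraph.Adj.symm hln)) (hLb l hl)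
        · exact h2
    have hLs : ∀ l ∈ L, l ∈ (Γ.neighborSet a ∩ Γ.neighborSet b)ᶜ := fun l hl h =>
      hLa l hl (Or.inr h.1)
    obtain ⟨l, hl⟩ := IsCompOf.nonempty hL
    obtain ⟨M, hM, hlM⟩ := exists_isCompOf (Γ := Γ) (hLs l hl)
    have hML : M = L := by
      apply Set.Subset.antisymm
      · refine IsCompOf.subset_of_closed hM hlM hl fun x hx _ y hy hxy => ?_
        by_contra hyL
        exact IsCompOf.subset hM hy (hlk x hx y hyL hxy)
      · exact IsCompOf.subset_of_closed hL hl hlM fun x hx _ y hy hxy =>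
          IsCompOf.mem_of_adj hM hx (hLs y hy) hxy
    exact ⟨a, b, hab, hadj, M, hM, hML ▸ haL, hML ▸ hbL⟩
  obtain ⟨l, hl, n, hnL, hna, hln⟩ := hex
  have hnb : Γ.Adj b n := by
    by_contra h
    apply hnL
    refine IsCompOf.mem_of_adj hL hl ?_ hln
    rintro (rfl | h')
    · exact hLb l hl (Or.inr (SimpleGraph.Adj.symm hln))
    · exact h h'
  constructor
  · intro hbK
    have hnK := IsCompOf.mem_of_adj hK hbK hna hnb
    exact hsub l hl (IsCompOf.mem_of_adj hK hnK (hLa l hl) hln.symm)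
  · intro hbK
    rw [Set.disjoint_left]
    intro x hx hxK
    have hlK := hsub x hx hxK hl
    exact hbK (IsCompOf.mem_of_adj hK (IsCompOf.mem_of_adj hK hlK hna hln) hbstar hnb.symm)

theorem pconj_commute_of_nested {a b : V} {K L : Set V} (hK : IsPCDomain Γ a K)
    (hL : IsPCDomain Γ b L) (ha : a ∉ L) (h1 : b ∈ K → L ⊆ K)
    (h2 : b ∉ K → Disjoint L K ∨ Commute (raagGen Γ a) (raagGen Γ b)) :
    Commute (pconj hK true) (pconj hL true) := by
  apply mulAut_ext
  intro v
  simp only [MulAut.mul_apply]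
  by_cases hvK : v ∈ K <;> by_cases hvL : v ∈ L <;> by_cases hb : b ∈ K
  · simp [pconj_gen, *]; group
  · have h3 : Commute (raagGen Γ a) (raagGen Γ b) :=
      (h2 hb).resolve_left fun h => Set.disjoint_left.1 h hvL hvK
    simp only [pconj_gen, hvK, hvL, hb, ha, letter_true, map_mul, map_inv, if_true, if_false]
    calc _ = (raagGen Γ b * raagGen Γ a) * raagGen Γ v * (raagGen Γ b * raagGen Γ a)⁻¹ := by
          group
      _ = _ := by rw [← h3.eq]; group
  · simp [pconj_gen, *]
  · simp [pconj_gen, *]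
  · exact absurd (h1 hb hvL) hvK
  · simp [pconj_gen, *]
  · simp [pconj_gen, *]
  · simp [pconj_gen, *]

/-- The graph on the partial conjugations that presents `PΣ(A(Γ))` when there is no SIL. -/
def pcGraph (Γ : SimpleGraph V) : SimpleGraph (PCSet Γ) where
  Adj p q := p ≠ q ∧ ¬(q.1.1 ∈ p.1.2 ∧ p.1.1 ∈ q.1.2)
  symm := ⟨fun _ _ h => ⟨h.1.symm, fun h' => h.2 h'.symm⟩⟩
  loopless := ⟨fun _ h => h.1 rfl⟩

theorem notMem_pc (p : PCSet Γ) : p.1.1 ∉ p.1.2 := fun h =>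
  IsCompOf.subset p.2 h (Set.mem_insert _ _)

theorem pc_disjoint {p q : PCSet Γ} (h : p.1.1 = q.1.1) (hpq : p ≠ q) {v : V} (hp : v ∈ p.1.2) :
    v ∉ q.1.2 := by
  intro hq
  apply hpq
  apply Subtype.ext
  apply Prod.ext h
  have h1 : IsCompOf Γ (Gstar Γ p.1.1)ᶜ p.1.2 := p.2
  rw [h] at h1
  exact IsCompOf.eq_of_mem h1 q.2 hp hq

/-- The partial conjugation attached to a vertex of `pcGraph Γ`. -/
noncomputable def pcAut (p : PCSet Γ) : PSA Γ :=
  ⟨pconj (IsCompOf.isDomain p.2) true, pconj_mem_PSA _ _⟩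

theorem pcAut_gen (p : PCSet Γ) (v : V) : (pcAut p).1 (raagGen Γ v) =
    if v ∈ p.1.2 then raagGen Γ p.1.1 * raagGen Γ v * (raagGen Γ p.1.1)⁻¹ else raagGen Γ v :=
  pconj_gen _ _ _

theorem pcAut_commute_of_notMem (hsil : ¬HasSIL Γ) {p q : PCSet Γ} (hpq : p ≠ q)
    (h : p.1.1 ∉ q.1.2) : Commute (pcAut p) (pcAut q) := by
  have hq : q.1.1 = p.1.1 → Disjoint q.1.2 p.1.2 := fun hqp => by
    rw [Set.disjoint_left]
    exact fun v hv => pc_disjoint hqp hpq.symm hv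
  have : Commute (pcAut p).1 (pcAut q).1 := by
    by_cases hab : p.1.1 = q.1.1
    · exact pconj_commute_of_nested _ _ h (fun h' => absurd h' (hab ▸ notMem_pc p))
        fun _ => Or.inl (hq hab.symm)
    by_cases hadj : Γ.Adj p.1.1 q.1.1
    · exact pconj_commute_of_nested _ _ h
        (fun h' => absurd (Or.inr hadj) (IsCompOf.subset p.2 h'))
        fun _ => Or.inr (gen_commute hadj)
    · have := subset_or_disjoint_of_no_sil hsil hab hadj p.2 q.2 h
      exact pconj_commute_of_nested _ _ h this.1 fun h' => Or.inl (this.2 h')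
  exact Subtype.ext this

theorem pcAut_commute (hsil : ¬HasSIL Γ) {p q : PCSet Γ} (h : (pcGraph Γ).Adj p q) :
    Commute (pcAut p) (pcAut q) := by
  by_cases hp : p.1.1 ∈ q.1.2
  · exact (pcAut_commute_of_notMem hsil h.1.symm fun hq => h.2 ⟨hq, hp⟩).symm
  · exact pcAut_commute_of_notMem hsil h.1 hp

/-- The homomorphism from the right-angled Artin group of `pcGraph Γ` onto `PΣ(A(Γ))`. -/
noncomputable def pcMap (hsil : ¬HasSIL Γ) : RAAG (pcGraph Γ) →* PSA Γ :=
  raagLift pcAut fun _ _ => pcAut_commute hsil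

theorem pcMap_gen (hsil : ¬HasSIL Γ) (p : PCSet Γ) :
    pcMap hsil (raagGen (pcGraph Γ) p) = pcAut p :=
  raagLift_gen _ _ _

theorem pcMap_surjective [Fintype V] (hsil : ¬HasSIL Γ) :
    Function.Surjective (pcMap hsil) := by
  rintro ⟨φ, hφ⟩
  have h1 : Subgroup.closure {ψ | ∃ (a : V) (K : Set V) (h : IsCompOf Γ (Gstar Γ a)ᶜ K),
      ψ = pconj (IsCompOf.isDomain h) true} ≤ ((PSA Γ).subtype.comp (pcMap hsil)).range := by
    rw [Subgroup.closure_le]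
    rintro _ ⟨a, K, h, rfl⟩
    refine ⟨raagGen (pcGraph Γ) ⟨(a, K), h⟩, ?_⟩
    rw [MonoidHom.comp_apply, pcMap_gen]
    rfl
  obtain ⟨x, hx⟩ := h1 (mem_closure_pconj hφ)
  exact ⟨x, Subtype.ext hx⟩

theorem exists_pcInner [Finite V] (a : V) : ∃ g : RAAG (pcGraph Γ),
    g ∈ special (pcGraph Γ) {x | x.1.1 = a} ∧
    ∀ p : PCSet Γ, p.1.1 = a →
      ∃ q ∈ special (pcGraph Γ) {x | x.1.1 = a ∧ x ≠ p}, g = raagGen (pcGraph Γ) p * q := by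
  have : Fintype (PCSet Γ) := Fintype.ofFinite _
  let s : Finset (PCSet Γ) := Finset.univ.filter fun x => x.1.1 = a
  have hs : ∀ x, x ∈ s ↔ x.1.1 = a := fun x => by simp [s]
  have hcomm : (s : Set (PCSet Γ)).Pairwise
      (Function.onFun Commute (raagGen (pcGraph Γ))) := by
    intro x hx y hy hxy
    refine gen_commute (Γ := pcGraph Γ) ⟨hxy, fun h => notMem_pc x ?_⟩
    rw [(hs x).1 hx, ← (hs y).1 hy]
    exact h.1
  refine ⟨s.noncommProd _ hcomm, ?_, fun p hp => ?_⟩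
  · exact Subgroup.noncommProd_mem _ _ fun x hx =>
      letter_mem_special (Γ := pcGraph Γ) ((hs x).1 hx) true
  · refine ⟨_, ?_, (Finset.mul_noncommProd_erase s ((hs p).2 hp) _ hcomm).symm⟩
    exact Subgroup.noncommProd_mem _ _ fun x hx =>
      letter_mem_special (Γ := pcGraph Γ) (S := {x | x.1.1 = a ∧ x ≠ p})
        ⟨(hs x).1 (Finset.mem_of_mem_erase hx), Finset.ne_of_mem_erase hx⟩ true

theorem pcMap_injective [Finite V] (hsil : ¬HasSIL Γ) :
    Function.Injective (pcMap hsil) := by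
  choose f hf hf' using fun a => exists_pcInner (Γ := Γ) a
  have hfix : ∀ (p : PCSet Γ) (b : V), b ∉ p.1.2 → Commute (raagGen (pcGraph Γ) p) (f b) := by
    intro p b hb
    refine commute_of_mem_special (Γ := pcGraph Γ) ?_ (hf b) true
    rintro x rfl
    by_cases hx : x = p
    · exact Or.inl hx
    · exact Or.inr ⟨fun h => hx h.symm, fun h => hb h.1⟩
  have hcomm : ∀ a b, Γ.Adj a b → Commute (f a) (f b) := by
    intro a b hab
    have hle : special (pcGraph Γ) {x | x.1.1 = a} ≤ Subgroup.centralizer {f b} := by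
      rw [special, Subgroup.closure_le]
      rintro _ ⟨x, rfl, rfl⟩
      rw [SetLike.mem_coe, Subgroup.mem_centralizer_singleton_iff]
      exact (hfix x b fun h => IsCompOf.subset x.2 h (Or.inr hab)).eq
    exact (Subgroup.mem_centralizer_singleton_iff.1 (hle (hf a)))
  let Φ : RAAG Γ →* RAAG (pcGraph Γ) := raagLift f hcomm
  have hΦ : ∀ v, Φ (raagGen Γ v) = f v := fun v => raagLift_gen _ _ _
  have hgen : ∀ p u, raagGen (pcGraph Γ) p * Φ u * (raagGen (pcGraph Γ) p)⁻¹ =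
      Φ ((pcAut p).1 u) := by
    intro p u
    have : (MulAut.conj (raagGen (pcGraph Γ) p)).toMonoidHom.comp Φ =
        Φ.comp (pcAut p).1.toMonoidHom := by
      apply raag_hom_ext
      intro b
      simp only [MonoidHom.comp_apply, MulEquiv.coe_toMonoidHom, MulAut.conj_apply]
      rw [pcAut_gen, hΦ]
      split_ifs with hb
      · obtain ⟨q, hq, he⟩ := hf' _ p rfl
        have hqc : Commute q (f b) := by
          have hle : special (pcGraph Γ) {x | x.1.1 = p.1.1 ∧ x ≠ p} ≤
              Subgroup.centralizer {f b} := by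
            rw [special, Subgroup.closure_le]
            rintro _ ⟨x, hx, rfl⟩
            rw [SetLike.mem_coe, Subgroup.mem_centralizer_singleton_iff]
            exact (hfix x b (pc_disjoint hx.1.symm hx.2.symm hb)).eq
          exact (Subgroup.mem_centralizer_singleton_iff.1 (hle hq))
        rw [map_mul, map_mul, map_inv, hΦ, hΦ, he]
        calc _ = raagGen (pcGraph Γ) p * (f b * q) * q⁻¹ * (raagGen (pcGraph Γ) p)⁻¹ := by group
          _ = _ := by rw [← hqc.eq]; group
      · rw [hΦ, (hfix p b hb).eq, mul_inv_cancel_right]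
    exact DFunLike.congr_fun this u
  have hword : ∀ (l : List (PCSet Γ × Bool)) u,
      wordProd (pcGraph Γ) l * Φ u * (wordProd (pcGraph Γ) l)⁻¹ =
      Φ ((pcMap hsil (wordProd (pcGraph Γ) l)).1 u) := by
    intro l
    induction l with
    | nil => simp
    | cons x l ih =>
      intro u
      have hx : ∀ u, letter (pcGraph Γ) x.1 x.2 * Φ u * (letter (pcGraph Γ) x.1 x.2)⁻¹ =
          Φ ((pcMap hsil (letter (pcGraph Γ) x.1 x.2)).1 u) := by
        intro u
        obtain ⟨p, b⟩ := x
        cases b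
        · obtain ⟨w, rfl⟩ := (pcAut p).1.surjective u
          simp [← hgen, pcMap_gen, mul_assoc]
        · simp [hgen, pcMap_gen]
      have e : wordProd (pcGraph Γ) (x :: l) * Φ u * (wordProd (pcGraph Γ) (x :: l))⁻¹ =
          letter (pcGraph Γ) x.1 x.2 * (wordProd (pcGraph Γ) l * Φ u *
          (wordProd (pcGraph Γ) l)⁻¹) * (letter (pcGraph Γ) x.1 x.2)⁻¹ := by
        simp [mul_assoc]
      rw [e, ih, hx, wordProd_cons, map_mul]
      rfl
  rw [injective_iff_map_eq_one]
  intro h hh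
  have hc : ∀ a, Commute h (f a) := by
    intro a
    obtain ⟨l, rfl⟩ := exists_word h
    have := hword l (raagGen Γ a)
    rw [hh, hΦ] at this
    rw [mul_inv_eq_iff_eq_mul] at this
    change _ * _ = _ * _
    simpa [hΦ] using this
  have hstar : ∀ p, h ∈ special (pcGraph Γ) (Gstar (pcGraph Γ) p) := by
    intro p
    obtain ⟨q, hq, he⟩ := hf' _ p rfl
    refine mem_special_star_of_commute (special_mono ?_ hq) (he ▸ hc p.1.1)
    rintro x ⟨hx, hxp⟩
    exact ⟨hxp.symm, fun h' => notMem_pc p (hx ▸ h'.1)⟩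
  by_contra hne
  obtain ⟨p, b, hpb⟩ := exists_mem_half hne
  obtain ⟨v, hv⟩ := IsCompOf.nonempty p.2
  have hpv : p.1.1 ∈ (Gstar Γ v)ᶜ := by
    rintro (h' | h')
    · exact notMem_pc p (h' ▸ hv)
    · exact IsCompOf.subset p.2 hv (Or.inr (SimpleGraph.Adj.symm h'))
  obtain ⟨L, hL, hpL⟩ := exists_isCompOf (Γ := Γ) hpv
  let x : PCSet Γ := ⟨(v, L), hL⟩
  have hpx : p ∉ Gstar (pcGraph Γ) x := by
    rintro (h' | h')
    · have hpv' : p.1.1 = v := by rw [h']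
      exact notMem_pc p (by rw [hpv']; exact hv)
    · exact h'.2 ⟨hpL, hv⟩
  have := (mul_special_mem_half hpx (hstar x) b 1).1 (by simpa using hpb)
  exact one_notMem_half _ _ this

/-- Isomorphic graphs have isomorphic right-angled Artin groups. -/
def raagCongr {W : Type} {Δ : SimpleGraph W} (e : Γ ≃g Δ) : RAAG Γ ≃* RAAG Δ :=
  MonoidHom.toMulEquiv
    (raagLift (fun v => raagGen Δ (e v)) fun _ _ h => gen_commute (e.map_adj_iff.2 h))
    (raagLift (fun v => raagGen Γ (e.symm v)) fun _ _ h => gen_commute (e.symm.map_adj_iff.2 h))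
    (raag_hom_ext fun v => by simp) (raag_hom_ext fun v => by simp)

theorem exists_raag_of_no_sil [Fintype V] (hsil : ¬HasSIL Γ) :
    ∃ (n : ℕ) (Δ : SimpleGraph (Fin n)), Nonempty (↥(PSA Γ) ≃* RAAG Δ) := by
  obtain ⟨n, ⟨e⟩⟩ := Finite.exists_equiv_fin (PCSet Γ)
  exact ⟨n, (pcGraph Γ).map e.toEmbedding, ⟨(MulEquiv.ofBijective (pcMap hsil)
    ⟨pcMap_injective hsil, pcMap_surjective hsil⟩).symm.trans
      (raagCongr (SimpleGraph.Iso.map e (pcGraph Γ)))⟩⟩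

end NoSIL

section Weights

variable {V : Type} {Γ : SimpleGraph V}

/-- The homomorphism `A(Γ) → ℤ` with prescribed values on the generators. -/
def wtHom (Γ : SimpleGraph V) (α : V → ℤ) : RAAG Γ →* Multiplicative ℤ :=
  raagLift (fun v => Multiplicative.ofAdd (α v)) fun _ _ _ => Commute.all _ _

/-- The additive form of `wtHom`. -/
def wt (α : V → ℤ) (g : RAAG Γ) : ℤ := (wtHom Γ α g).toAdd

@[simp] theorem wt_one (α : V → ℤ) : wt α (1 : RAAG Γ) = 0 := by simp [wt]

@[simp] theorem wt_mul (α : V → ℤ) (g h : RAAG Γ) : wt α (g * h) = wt α g + wt α h := by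
  simp [wt]

@[simp] theorem wt_inv (α : V → ℤ) (g : RAAG Γ) : wt α g⁻¹ = -wt α g := by simp [wt]

@[simp] theorem wt_gen (α : V → ℤ) (v : V) : wt α (raagGen Γ v) = α v := by
  simp [wt, wtHom]

theorem eq_wt {α : V → ℤ} {f : RAAG Γ → ℤ} (hf : ∀ g h, f (g * h) = f g + f h)
    (hα : ∀ v, f (raagGen Γ v) = α v) (g : RAAG Γ) : f g = wt α g := by
  have : MonoidHom.mk' (fun g => Multiplicative.ofAdd (f g)) (fun g h => by rw [hf]; rfl) =
      wtHom Γ α := raag_hom_ext fun v => by simp [hα, wtHom]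
  exact congrArg Multiplicative.toAdd (DFunLike.congr_fun this g)

theorem wt_eq_zero_of_mem_special {α : V → ℤ} {S : Set V} (h : ∀ v ∈ S, α v = 0) {g : RAAG Γ}
    (hg : g ∈ special Γ S) : wt α g = 0 := by
  have : special Γ S ≤ (wtHom Γ α).ker := by
    rw [special, Subgroup.closure_le]
    rintro _ ⟨v, hv, rfl⟩
    simp [MonoidHom.mem_ker, wtHom, h v hv]
  exact congrArg Multiplicative.toAdd (MonoidHom.mem_ker.1 (this hg))

theorem wt_eq_sum [Fintype V] [DecidableEq V] (α : V → ℤ) (g : RAAG Γ) :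
    wt α g = ∑ u, α u * wt (Pi.single u 1) g := by
  symm
  apply eq_wt (f := fun g => ∑ u, α u * wt (Pi.single u 1) g)
  · intro g h
    simp [mul_add, Finset.sum_add_distrib]
  · intro v
    simp [Pi.single_apply]

end Weights

section Heisenberg

/-- The integral Heisenberg group. -/
@[ext] structure Heis where
  x : ℤ
  y : ℤ
  z : ℤ

namespace Heis

instance : Mul Heis := ⟨fun g h => ⟨g.x + h.x, g.y + h.y, g.z + h.z + g.x * h.y⟩⟩

instance : One Heis := ⟨⟨0, 0, 0⟩⟩

instance : Inv Heis := ⟨fun g => ⟨-g.x, -g.y, -g.z + g.x * g.y⟩⟩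

@[simp] theorem mul_x (g h : Heis) : (g * h).x = g.x + h.x := rfl
@[simp] theorem mul_y (g h : Heis) : (g * h).y = g.y + h.y := rfl
@[simp] theorem mul_z (g h : Heis) : (g * h).z = g.z + h.z + g.x * h.y := rfl
@[simp] theorem one_x : (1 : Heis).x = 0 := rfl
@[simp] theorem one_y : (1 : Heis).y = 0 := rfl
@[simp] theorem one_z : (1 : Heis).z = 0 := rfl
@[simp] theorem inv_x (g : Heis) : g⁻¹.x = -g.x := rfl
@[simp] theorem inv_y (g : Heis) : g⁻¹.y = -g.y := rfl
@[simp] theorem inv_z (g : Heis) : g⁻¹.z = -g.z + g.x * g.y := rfl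

instance : Group Heis := Group.ofLeftAxioms
  (fun a b c => by ext <;> simp <;> ring)
  (fun a => by ext <;> simp)
  (fun a => by ext <;> simp)

theorem commute_iff (g h : Heis) : Commute g h ↔ g.x * h.y = h.x * g.y := by
  constructor
  · intro hc
    have := congrArg Heis.z hc.eq
    simp only [mul_z] at this
    linarith
  · intro hc
    ext <;> simp only [mul_x, mul_y, mul_z] <;> linarith

end Heis

variable {V : Type} {Γ : SimpleGraph V}

/-- The homomorphism to the Heisenberg group determined by two compatible weights. -/
def heisHom (α β : V → ℤ) (h : ∀ u w, Γ.Adj u w → α u * β w = α w * β u) : RAAG Γ →* Heis :=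
  raagLift (fun v => ⟨α v, β v, 0⟩) fun u w huw => (Heis.commute_iff _ _).2 (h u w huw)

theorem heisHom_gen (α β : V → ℤ) (h : ∀ u w, Γ.Adj u w → α u * β w = α w * β u) (v : V) :
    heisHom α β h (raagGen Γ v) = ⟨α v, β v, 0⟩ :=
  raagLift_gen _ _ _

theorem heisHom_x (α β : V → ℤ) (h : ∀ u w, Γ.Adj u w → α u * β w = α w * β u) (g : RAAG Γ) :
    (heisHom α β h g).x = wt α g :=
  eq_wt (f := fun g => (heisHom α β h g).x) (by simp) (by simp [heisHom_gen]) g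

theorem heisHom_y (α β : V → ℤ) (h : ∀ u w, Γ.Adj u w → α u * β w = α w * β u) (g : RAAG Γ) :
    (heisHom α β h g).y = wt β g :=
  eq_wt (f := fun g => (heisHom α β h g).y) (by simp) (by simp [heisHom_gen]) g

theorem wt_mul_wt_of_commute {α β : V → ℤ} (h : ∀ u w, Γ.Adj u w → α u * β w = α w * β u)
    {g k : RAAG Γ} (hc : Commute g k) : wt α g * wt β k = wt α k * wt β g := by
  have := (Heis.commute_iff _ _).1 (hc.map (heisHom α β h))
  simpa only [heisHom_x, heisHom_y] using this

end Heisenberg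

section Isotropic

variable {G W : Type} [Group G] {Δ : SimpleGraph W} [DecidableEq W]

/-- Two weights on a group that is a right-angled Artin group, isotropic on commuting pairs,
constrain the support of the elements that commute with a nondegenerate pair. -/
theorem support_of_isotropic (e : G ≃* RAAG Δ) {ξ η : G → ℤ}
    (hξ : ∀ g h, ξ (g * h) = ξ g + ξ h) (hη : ∀ g h, η (g * h) = η g + η h)
    (hiso : ∀ g h, Commute g h → ξ g * η h = ξ h * η g) {g A B : G} (hA : Commute g A)
    (hB : Commute g B) (h1 : ξ g = 0) (h2 : η g = 0) (hne : ξ A * η B - ξ B * η A ≠ 0) (u : W) :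
    wt (Pi.single u 1) (e g) = 0 ∨
      (ξ (e.symm (raagGen Δ u)) = 0 ∧ η (e.symm (raagGen Δ u)) = 0) := by
  set v : W → G := fun w => e.symm (raagGen Δ w)
  let ζ : G → ℤ := fun g => ξ (v u) * η g - η (v u) * ξ g
  have hζ : ∀ k, ζ k = wt (fun w => ζ (v w)) (e k) := by
    intro k
    have := eq_wt (Γ := Δ) (f := fun x => ζ (e.symm x)) (α := fun w => ζ (v w))
      (fun a b => by simp only [ζ, map_mul, hξ, hη]; ring) (fun _ => rfl) (e k)
    simpa using this
  have hedge : ∀ a b, Δ.Adj a b → (Pi.single u 1 : W → ℤ) a * ζ (v b) =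
      (Pi.single u 1 : W → ℤ) b * ζ (v a) := by
    have hu : ∀ b, Δ.Adj u b → ζ (v b) = 0 := by
      intro b hb
      have := hiso (v u) (v b) ((gen_commute hb).map e.symm.toMonoidHom)
      simp only [ζ]
      linarith
    intro a b hab
    by_cases ha : a = u
    · subst ha
      simp [hu b hab, hab.ne']
    · by_cases hb : b = u
      · subst hb
        simp [hu a hab.symm, ha]
      · simp [ha, hb]
  have hg : ζ g = 0 := by simp [ζ, h1, h2]
  have key : ∀ k, Commute g k → wt (Pi.single u 1) (e g) = 0 ∨ ζ k = 0 := by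
    intro k hk
    have := wt_mul_wt_of_commute (Γ := Δ) hedge (hk.map e.toMonoidHom)
    change wt _ (e g) * wt _ (e k) = wt _ (e k) * wt _ (e g) at this
    rw [← hζ, ← hζ, hg, mul_zero] at this
    exact mul_eq_zero.1 this
  rcases key A hA with h | hAζ
  · exact Or.inl h
  rcases key B hB with h | hBζ
  · exact Or.inl h
  right
  simp only [ζ] at hAζ hBζ
  constructor
  · apply (mul_eq_zero.1 _).resolve_right hne
    linear_combination ξ A * hBζ - ξ B * hAζ
  · apply (mul_eq_zero.1 _).resolve_right hne
    linear_combination η A * hBζ - η B * hAζ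

end Isotropic

section Conjugators

variable {V : Type} {Γ : SimpleGraph V}

/-- A conjugator for the image of `v` under a pure symmetric automorphism. -/
noncomputable def cj (φ : PSA Γ) (v : V) : RAAG Γ := (mem_PSA_iff.1 φ.2 v).choose

theorem cj_spec (φ : PSA Γ) (v : V) :
    φ.1 (raagGen Γ v) = cj φ v * raagGen Γ v * (cj φ v)⁻¹ :=
  (mem_PSA_iff.1 φ.2 v).choose_spec

theorem inv_mul_mem_of_conj_eq {v : V} {g h : RAAG Γ}
    (e : g * raagGen Γ v * g⁻¹ = h * raagGen Γ v * h⁻¹) : h⁻¹ * g ∈ special Γ (Gstar Γ v) := by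
  apply mem_special_star_of_commute_gen
  rw [mul_inv_eq_iff_eq_mul] at e
  change _ * _ = _ * _
  rw [mul_assoc, e]
  group

theorem cj_mul (φ ψ : PSA Γ) (v : V) : (φ * ψ).1 (raagGen Γ v) =
    (φ.1 (cj ψ v) * cj φ v) * raagGen Γ v * (φ.1 (cj ψ v) * cj φ v)⁻¹ := by
  change φ.1 (ψ.1 _) = _
  rw [cj_spec ψ, map_mul, map_mul, map_inv, cj_spec φ]
  group

theorem wt_apply (α : V → ℤ) (φ : PSA Γ) (g : RAAG Γ) : wt α (φ.1 g) = wt α g :=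
  eq_wt (f := fun g => wt α (φ.1 g)) (by simp) (fun v => by rw [cj_spec]; simp) g

variable [DecidableEq V]

/-- The total exponent of `a` in the conjugator of `v`. -/
noncomputable def cw (a v : V) (φ : PSA Γ) : ℤ := wt (Pi.single a 1) (cj φ v)

theorem cw_eq {a v : V} (hav : a ∉ Gstar Γ v) {φ : PSA Γ} {g : RAAG Γ}
    (h : φ.1 (raagGen Γ v) = g * raagGen Γ v * g⁻¹) : cw a v φ = wt (Pi.single a 1) g := by
  have h1 := wt_eq_zero_of_mem_special (α := Pi.single a 1)
    (fun w hw => Pi.single_eq_of_ne (ne_of_mem_of_not_mem hw hav) 1)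
    (inv_mul_mem_of_conj_eq ((cj_spec φ v).symm.trans h))
  rw [wt_mul, wt_inv] at h1
  rw [cw]
  linarith

theorem cw_mul {a v : V} (hav : a ∉ Gstar Γ v) (φ ψ : PSA Γ) :
    cw a v (φ * ψ) = cw a v φ + cw a v ψ := by
  rw [cw_eq hav (cj_mul φ ψ v), wt_mul, wt_apply, add_comm]
  rfl

theorem cw_inv {a v : V} (hav : a ∉ Gstar Γ v) (φ : PSA Γ) : cw a v φ⁻¹ = -cw a v φ := by
  have h := cw_mul hav φ φ⁻¹
  have h1 : cw a v (1 : PSA Γ) = 0 := by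
    have := cw_mul hav (1 : PSA Γ) 1
    rw [mul_one] at this
    linarith
  rw [mul_inv_cancel, h1] at h
  linarith

/-- The relation between exponents of conjugators of commuting automorphisms. -/
theorem cw_relation {a b v : V} (hab : a ∉ Gstar Γ b) (hba : b ∉ Gstar Γ a)
    (hav : a ∉ Gstar Γ v) {φ ψ : PSA Γ} (hc : Commute φ ψ) :
    cw a b φ * cw b v ψ - cw b a φ * cw a v ψ + cw a v ψ * cw b v φ =
      cw a b ψ * cw b v φ - cw b a ψ * cw a v φ + cw a v φ * cw b v ψ := by
  have hne : a ≠ b := fun h => hab (Or.inl h)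
  have hedge : ∀ u w, Γ.Adj u w → (Pi.single a 1 : V → ℤ) u * (Pi.single b 1 : V → ℤ) w =
      (Pi.single a 1 : V → ℤ) w * (Pi.single b 1 : V → ℤ) u := by
    have : ∀ u w, Γ.Adj u w →
        (Pi.single a 1 : V → ℤ) u * (Pi.single b 1 : V → ℤ) w = 0 := by
      intro u w huw
      by_cases hu : u = a
      · by_cases hw : w = b
        · subst hu hw
          exact absurd (Or.inr huw) hba
        · simp [Pi.single_apply, hw]
      · simp [Pi.single_apply, hu]
    intro u w huw
    rw [this u w huw, this w u huw.symm]
  let H := heisHom (Γ := Γ) _ _ hedge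
  have hHx : ∀ g, (H g).x = wt (Pi.single a 1) g := heisHom_x _ _ hedge
  have hHy : ∀ g, (H g).y = wt (Pi.single b 1) g := heisHom_y _ _ hedge
  have hconj : ∀ (θ : PSA Γ) g, H (θ.1 g) =
      ⟨cw a b θ, cw b a θ, 0⟩ * H g * (⟨cw a b θ, cw b a θ, 0⟩ : Heis)⁻¹ := by
    intro θ g
    have : H.comp θ.1.toMonoidHom =
        (MulAut.conj (⟨cw a b θ, cw b a θ, 0⟩ : Heis)).toMonoidHom.comp H := by
      apply raag_hom_ext
      intro w
      simp only [MonoidHom.comp_apply, MulEquiv.coe_toMonoidHom, MulAut.conj_apply]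
      rw [cj_spec, map_mul, map_mul, map_inv, heisHom_gen]
      by_cases hwa : w = a
      · subst hwa
        ext <;> simp [hHx, hHy, hne, cw]; ring
      · by_cases hwb : w = b
        · subst hwb
          ext <;> simp [hHx, hHy, hne.symm, cw]; ring
        · ext <;> simp [hwa, hwb]
    exact DFunLike.congr_fun this g
  have hz : ∀ (θ : PSA Γ) g, (H (θ.1 g)).z =
      (H g).z + cw a b θ * (H g).y - cw b a θ * (H g).x := by
    intro θ g
    rw [hconj]
    simp
    ring
  have h1 : (φ.1 (cj ψ v) * cj φ v) * raagGen Γ v * (φ.1 (cj ψ v) * cj φ v)⁻¹ =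
      (ψ.1 (cj φ v) * cj ψ v) * raagGen Γ v * (ψ.1 (cj φ v) * cj ψ v)⁻¹ := by
    rw [← cj_mul, ← cj_mul, hc.eq]
  have h2 := inv_mul_mem_of_conj_eq h1
  set k := (ψ.1 (cj φ v) * cj ψ v)⁻¹ * (φ.1 (cj ψ v) * cj φ v) with hk
  have h3 : φ.1 (cj ψ v) * cj φ v = ψ.1 (cj φ v) * cj ψ v * k := by rw [hk]; group
  have hkz : (H k).z = 0 := by
    obtain ⟨l, hl, e⟩ := exists_word_of_mem_special h2
    rw [← e]
    clear e h2 h3 hk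
    have : (H (wordProd Γ l)).x = 0 ∧ (H (wordProd Γ l)).z = 0 := by
      induction l with
      | nil => simp
      | cons y l ih =>
        obtain ⟨i1, i2⟩ := ih fun x hx => hl x (by simp [hx])
        have hya : y.1 ≠ a := fun h => hav (h ▸ hl y (by simp))
        have hy : (H (letter Γ y.1 y.2)).x = 0 ∧ (H (letter Γ y.1 y.2)).z = 0 := by
          cases y.2 <;> simp [H, heisHom_gen, hya]
        simp [i1, i2, hy.1, hy.2]
    exact this.2
  have hky : (H k).y = 0 := by
    rw [hHy, hk]
    simp only [wt_mul, wt_inv, wt_apply]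
    ring
  have h4 := congrArg (fun g => (H g).z) h3
  simp only [map_mul, Heis.mul_z, hz, hkz, hky, hHx, hHy, wt_apply] at h4
  simp only [cw] at h4 ⊢
  linarith

end Conjugators

section SIL

open scoped Classical

variable {V : Type} {Γ : SimpleGraph V}

theorem isPCDomain_univ (a : V) : IsPCDomain Γ a Set.univ :=
  fun _ _ w hw _ => absurd (Set.mem_univ w) hw

/-- Conjugation of the vertices of `K` by `a`, as a pure symmetric automorphism. -/
noncomputable def pcElt {a : V} {K : Set V} (h : IsPCDomain Γ a K) : PSA Γ :=
  ⟨pconj h true, pconj_mem_PSA h true⟩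

theorem pcElt_gen_of_mem {a : V} {K : Set V} (h : IsPCDomain Γ a K) {v : V} (hv : v ∈ K) :
    (pcElt h).1 (raagGen Γ v) = raagGen Γ a * raagGen Γ v * (raagGen Γ a)⁻¹ := by
  rw [pcElt, pconj_gen, if_pos hv]
  rfl

theorem pcElt_gen_of_notMem {a : V} {K : Set V} (h : IsPCDomain Γ a K) {v : V} (hv : v ∉ K) :
    (pcElt h).1 (raagGen Γ v) = raagGen Γ v := by
  rw [pcElt, pconj_gen, if_neg hv]

theorem cw_pcElt {a c v : V} {K : Set V} (h : IsPCDomain Γ a K) (hcv : c ∉ Gstar Γ v) :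
    cw c v (pcElt h) = if v ∈ K ∧ a = c then 1 else 0 := by
  by_cases hv : v ∈ K
  · rw [cw_eq hcv (pcElt_gen_of_mem h hv), wt_gen, Pi.single_apply]
    simp [hv]
  · rw [cw_eq hcv (g := 1) (by rw [pcElt_gen_of_notMem h hv]; simp)]
    simp [hv]

/-- The inner automorphism of `a` commutes with every automorphism fixing `a`. -/
theorem inner_commute (a : V) {φ : PSA Γ} (h : φ.1 (raagGen Γ a) = raagGen Γ a) :
    Commute φ (pcElt (isPCDomain_univ a)) := by
  have hconj : ∀ g, (pcElt (isPCDomain_univ (Γ := Γ) a)).1 g =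
      raagGen Γ a * g * (raagGen Γ a)⁻¹ := by
    have : (pcElt (isPCDomain_univ (Γ := Γ) a)).1 = MulAut.conj (raagGen Γ a) :=
      mulAut_ext fun v => by
        rw [pcElt_gen_of_mem _ (Set.mem_univ v), MulAut.conj_apply]
    intro g
    rw [this, MulAut.conj_apply]
  apply Subtype.ext
  apply MulEquiv.ext
  intro g
  change φ.1 ((pcElt (isPCDomain_univ a)).1 g) = (pcElt (isPCDomain_univ a)).1 (φ.1 g)
  simp [hconj, h]

theorem not_hasSIL_of_raag {W : Type} [Fintype W] {Δ : SimpleGraph W}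
    (e : PSA Γ ≃* RAAG Δ) : ¬HasSIL Γ := by
  rintro ⟨a, b, hab, hadj, M, hM, haM, hbM⟩
  obtain ⟨m, hm⟩ := IsCompOf.nonempty hM
  have hdom : ∀ v ∈ M, ∀ w ∉ M, Γ.Adj v w → w ∈ Γ.neighborSet a ∩ Γ.neighborSet b := by
    intro v hv w hw hvw
    by_contra h
    exact hw (IsCompOf.mem_of_adj hM hv h hvw)
  have hMa : IsPCDomain Γ a M := fun v hv w hw hvw => Or.inr (hdom v hv w hw hvw).1
  have hMb : IsPCDomain Γ b M := fun v hv w hw hvw => Or.inr (hdom v hv w hw hvw).2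
  have hstar : ∀ {v w : V}, v ∉ Gstar Γ w → w ∉ Gstar Γ v := by
    rintro v w h (h' | h')
    exacts [h (Or.inl h'.symm), h (Or.inr (SimpleGraph.Adj.symm h'))]
  have hba : b ∉ Gstar Γ a := by
    rintro (h | h)
    exacts [hab h.symm, hadj h]
  have ham : a ∉ Gstar Γ m := by
    rintro (h | h)
    · exact haM (h ▸ hm)
    · exact Γ.loopless.irrefl a (hdom m hm a haM h).1
  have hbm : b ∉ Gstar Γ m := by
    rintro (h | h)
    · exact hbM (h ▸ hm)
    · exact Γ.loopless.irrefl b (hdom m hm b hbM h).2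
  have hab' := hstar hba
  have hma := hstar ham
  have hneam : a ≠ m := fun h => ham (Or.inl h)
  have hnebm : b ≠ m := fun h => hbm (Or.inl h)
  let pa := pcElt hMa
  let pb := pcElt hMb
  let ia := pcElt (isPCDomain_univ (Γ := Γ) a)
  let ib := pcElt (isPCDomain_univ (Γ := Γ) b)
  let im := pcElt (isPCDomain_univ (Γ := Γ) m)
  have hpaa : pa.1 (raagGen Γ a) = raagGen Γ a := pcElt_gen_of_notMem hMa haM
  have c1 : Commute pa ia := inner_commute a hpaa
  have c2 : Commute pa ib := inner_commute b (pcElt_gen_of_notMem hMa hbM)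
  have c3 : Commute ia pb := (inner_commute a (pcElt_gen_of_notMem hMb haM)).symm
  have c4 : Commute (pa⁻¹ * ia) pa := (Commute.refl pa).inv_left.mul_left c1.symm
  have c5 : Commute (pa⁻¹ * ia) im := by
    apply inner_commute
    change pa.1⁻¹ (ia.1 (raagGen Γ m)) = _
    rw [MulAut.inv_apply, MulEquiv.symm_apply_eq]
    rw [pcElt_gen_of_mem _ (Set.mem_univ m), pcElt_gen_of_mem _ hm]
  have iso1 : ∀ φ ψ : PSA Γ, Commute φ ψ → cw a b φ * cw b a ψ = cw a b ψ * cw b a φ := by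
    intro φ ψ hc
    have := cw_relation hab' hba hab' hc
    linarith
  have iso2 : ∀ φ ψ : PSA Γ, Commute φ ψ → cw a m φ * cw m a ψ = cw a m ψ * cw m a φ := by
    intro φ ψ hc
    have := cw_relation ham hma ham hc
    linarith
  have iso3 : ∀ φ ψ : PSA Γ, Commute φ ψ →
      (cw a b φ - cw a m φ) * (cw b a ψ - cw b m ψ) =
      (cw a b ψ - cw a m ψ) * (cw b a φ - cw b m φ) := by
    intro φ ψ hc
    have h1 := cw_relation hab' hba ham hc
    have h2 := iso1 φ ψ hc
    linarith
  have add1 := cw_mul hab'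
  have add2 := cw_mul hba
  have add3 := cw_mul ham
  have add4 := cw_mul hma
  have add5 := cw_mul hbm
  have inv3 := cw_inv ham
  have inv4 := cw_inv hma
  have hab₂ := hab.symm
  have hneam' := hneam.symm
  have hpa : cw a b pa - cw a m pa = -1 := by
    simp [pa, cw_pcElt, hab', ham, hm, hbM]
  have key : ∀ u, cw a b (e.symm (raagGen Δ u)) - cw a m (e.symm (raagGen Δ u)) = 0 ∨
      wt (Pi.single u 1) (e pa) = 0 := by
    intro u
    rcases support_of_isotropic e add1 add2 iso1 c1 c2
      (by simp [pa, cw_pcElt, hab', hbM]) (by simp [pa, cw_pcElt, hba, haM])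
      (by simp [ia, ib, cw_pcElt, hab', hba, hab, hab₂]) u with h1 | h1
    · exact Or.inr h1
    rcases support_of_isotropic e add3 add4 iso2 c4 c5
      (by simp [add3, inv3, pa, ia, cw_pcElt, ham, hm])
      (by simp [add4, inv4, pa, ia, cw_pcElt, hma, haM, hneam])
      (by simp [pa, im, cw_pcElt, ham, hma, hm, haM, hneam, hneam']) u with h2 | h2
    swap
    · left
      rw [h1.1, h2.1, sub_zero]
    rcases support_of_isotropic e (ξ := fun φ => cw a b φ - cw a m φ)
      (η := fun φ => cw b a φ - cw b m φ) (fun φ ψ => by simp only [add1, add3]; ring)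
      (fun φ ψ => by simp only [add2, add5]; ring) iso3 c1.symm c3
      (by simp [ia, cw_pcElt, hab', ham])
      (by simp [ia, cw_pcElt, hba, hbm, hab])
      (by simp [pa, pb, cw_pcElt, hab', hba, ham, hbm, hab, hab₂, haM, hbM, hm]) u with h3 | h3
    · right
      rw [map_mul, map_inv, wt_mul, wt_inv, h3] at h2
      linarith
    · exact Or.inl h3.1
  have hsum := eq_wt (Γ := Δ)
    (f := fun x => cw a b (e.symm x) - cw a m (e.symm x)) (fun x y => by
      simp only [map_mul, add1, add3]; ring) (fun _ => rfl) (e pa)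
  rw [wt_eq_sum, Finset.sum_eq_zero fun u _ => mul_eq_zero.2 (key u)] at hsum
  simp only [MulEquiv.symm_apply_apply] at hsum
  rw [hpa] at hsum
  norm_num at hsum

end SIL

end RaagPSA

/-- Theorem B. `PΣ(A(Γ))` is isomorphic to a right-angled Artin group
if and only if `Γ` contains no SIL. -/
theorem psa_isom_raag_iff_no_sil {V : Type} [Fintype V] (Γ : SimpleGraph V) :
    (∃ (n : ℕ) (Δ : SimpleGraph (Fin n)), Nonempty (↥(PSA Γ) ≃* RAAG Δ)) ↔ ¬HasSIL Γ := by
  constructor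
  · rintro ⟨n, Δ, ⟨e⟩⟩
    exact RaagPSA.not_hasSIL_of_raag e
  · exact RaagPSA.exists_raag_of_no_sil
end

section
/- Let Γ be a finite simplicial graph defining the right-angled Artin group A = A(Γ). If Γ contains a SIL, then the pure symmetric automorphism group PΣ(A) is not isomorphic to any right-angled Artin group. -/
open SimpleGraph

/-- Upper unitriangular `4 × 4` integer matrices, given by their entries above the diagonal. -/
@[ext]
structure Unitri where
  e12 : ℤ
  e23 : ℤ
  e34 : ℤ
  e13 : ℤ
  e24 : ℤ
  e14 : ℤ

namespace Unitri

instance : Mul Unitri where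
  mul p q :=
    { e12 := p.e12 + q.e12
      e23 := p.e23 + q.e23
      e34 := p.e34 + q.e34
      e13 := p.e13 + q.e13 + p.e12 * q.e23
      e24 := p.e24 + q.e24 + p.e23 * q.e34
      e14 := p.e14 + q.e14 + p.e12 * q.e24 + p.e13 * q.e34 }

instance : One Unitri where
  one := ⟨0, 0, 0, 0, 0, 0⟩

instance : Inv Unitri where
  inv p :=
    { e12 := -p.e12
      e23 := -p.e23
      e34 := -p.e34
      e13 := -p.e13 + p.e12 * p.e23
      e24 := -p.e24 + p.e23 * p.e34
      e14 := -p.e14 + p.e12 * p.e24 + p.e13 * p.e34 - p.e12 * p.e23 * p.e34 }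

variable (p q : Unitri)

@[simp] lemma mul_e12 : (p * q).e12 = p.e12 + q.e12 := rfl
@[simp] lemma mul_e23 : (p * q).e23 = p.e23 + q.e23 := rfl
@[simp] lemma mul_e34 : (p * q).e34 = p.e34 + q.e34 := rfl
@[simp] lemma mul_e13 : (p * q).e13 = p.e13 + q.e13 + p.e12 * q.e23 := rfl
@[simp] lemma mul_e24 : (p * q).e24 = p.e24 + q.e24 + p.e23 * q.e34 := rfl
@[simp] lemma mul_e14 :
    (p * q).e14 = p.e14 + q.e14 + p.e12 * q.e24 + p.e13 * q.e34 := rfl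
@[simp] lemma one_e12 : (1 : Unitri).e12 = 0 := rfl
@[simp] lemma one_e23 : (1 : Unitri).e23 = 0 := rfl
@[simp] lemma one_e34 : (1 : Unitri).e34 = 0 := rfl
@[simp] lemma one_e13 : (1 : Unitri).e13 = 0 := rfl
@[simp] lemma one_e24 : (1 : Unitri).e24 = 0 := rfl
@[simp] lemma one_e14 : (1 : Unitri).e14 = 0 := rfl
@[simp] lemma inv_e12 : (p⁻¹).e12 = -p.e12 := rfl
@[simp] lemma inv_e23 : (p⁻¹).e23 = -p.e23 := rfl
@[simp] lemma inv_e34 : (p⁻¹).e34 = -p.e34 := rfl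
@[simp] lemma inv_e13 : (p⁻¹).e13 = -p.e13 + p.e12 * p.e23 := rfl
@[simp] lemma inv_e24 : (p⁻¹).e24 = -p.e24 + p.e23 * p.e34 := rfl
@[simp] lemma inv_e14 : (p⁻¹).e14 =
    -p.e14 + p.e12 * p.e24 + p.e13 * p.e34 - p.e12 * p.e23 * p.e34 := rfl

instance : Group Unitri :=
  Group.ofLeftAxioms (fun p q r => by ext <;> simp <;> ring)
    (fun p => by ext <;> simp) (fun p => by ext <;> simp; ring)

end Unitri

section Raag

variable {V : Type} {Γ : SimpleGraph V}

lemma raag_induction {P : RAAG Γ → Prop} (gen : ∀ v, P (raagGen Γ v)) (one : P 1)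
    (mul : ∀ g h, P g → P h → P (g * h)) (inv : ∀ g, P g → P g⁻¹) (g : RAAG Γ) : P g := by
  have hg : g ∈ Subgroup.closure (Set.range (PresentedGroup.of (rels := raagRels Γ))) := by
    rw [PresentedGroup.closure_range_of]; trivial
  induction hg using Subgroup.closure_induction with
  | mem x hx => obtain ⟨v, rfl⟩ := hx; exact gen v
  | one => exact one
  | mul x y _ _ hx hy => exact mul x y hx hy
  | inv x _ hx => exact inv x hx

/-- The homomorphism out of `A(Γ)` with prescribed values on the generators. -/
def raagLift {G : Type*} [Group G] (f : V → G) (hf : ∀ u v, Γ.Adj u v → f u * f v = f v * f u) :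
    RAAG Γ →* G :=
  PresentedGroup.toGroup (f := f) (by
    rintro r ⟨a, b, hab, rfl⟩
    simp only [map_mul, map_inv, FreeGroup.lift_apply_of]
    rw [hf a b hab]; group)

@[simp] lemma raagLift_gen {G : Type*} [Group G] (f : V → G)
    (hf : ∀ u v, Γ.Adj u v → f u * f v = f v * f u) (v : V) :
    raagLift f hf (raagGen Γ v) = f v :=
  PresentedGroup.toGroup.of _

lemma raag_hom_ext {G : Type*} [Group G] {f g : RAAG Γ →* G}
    (h : ∀ v, f (raagGen Γ v) = g (raagGen Γ v)) : f = g :=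
  PresentedGroup.ext h

lemma raagGen_commute {u v : V} (h : Γ.Adj u v) : Commute (raagGen Γ u) (raagGen Γ v) := by
  have : raagGen Γ u * raagGen Γ v * (raagGen Γ u)⁻¹ * (raagGen Γ v)⁻¹ = 1 :=
    PresentedGroup.one_of_mem ⟨u, v, h, rfl⟩
  rw [mul_inv_eq_one, mul_inv_eq_iff_eq_mul] at this
  exact this

/-- The character of `A(Γ)` taking the value `l v` at the generator `v`. -/
def expSum (l : V → ℤ) : RAAG Γ →* Multiplicative ℤ :=
  raagLift (fun v => Multiplicative.ofAdd (l v)) (fun _ _ _ => mul_comm _ _)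

/-- Integer-valued form of `expSum`. -/
def ex (l : V → ℤ) (g : RAAG Γ) : ℤ := (expSum l g).toAdd

@[simp] lemma ex_gen (l : V → ℤ) (v : V) : ex l (raagGen Γ v) = l v := by
  simp [ex, expSum]

@[simp] lemma ex_one (l : V → ℤ) : ex l (1 : RAAG Γ) = 0 := by simp [ex]

@[simp] lemma ex_mul (l : V → ℤ) (g h : RAAG Γ) : ex l (g * h) = ex l g + ex l h := by
  simp [ex]

@[simp] lemma ex_inv (l : V → ℤ) (g : RAAG Γ) : ex l g⁻¹ = -ex l g := by simp [ex]

lemma ex_unique (l : V → ℤ) (χ : RAAG Γ →* Multiplicative ℤ)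
    (h : ∀ v, (χ (raagGen Γ v)).toAdd = l v) (g : RAAG Γ) : (χ g).toAdd = ex l g := by
  have : χ = expSum l := raag_hom_ext fun v => by
    have := ex_gen (Γ := Γ) l v
    rw [← h v] at this
    exact Multiplicative.toAdd.injective this.symm
  rw [this, ex]

/-- Two vertex functions are isotropic if their cup product vanishes on every edge. -/
def EdgeIso (Γ : SimpleGraph V) (l k : V → ℤ) : Prop :=
  ∀ u v, Γ.Adj u v → l u * k v = l v * k u

/-- The unitriangular representation with prescribed superdiagonal characters. -/
def unitriRep (l₁ l₂ l₃ : V → ℤ) (h₁ : EdgeIso Γ l₁ l₂) (h₂ : EdgeIso Γ l₂ l₃) :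
    RAAG Γ →* Unitri :=
  raagLift (fun v => ⟨l₁ v, l₂ v, l₃ v, 0, 0, 0⟩) (fun u v huv => by
    have := h₁ u v huv
    have := h₂ u v huv
    ext <;> simp <;> linarith)

section Rep

variable (l₁ l₂ l₃ : V → ℤ) (h₁ : EdgeIso Γ l₁ l₂) (h₂ : EdgeIso Γ l₂ l₃)

@[simp] lemma unitriRep_gen (v : V) :
    unitriRep l₁ l₂ l₃ h₁ h₂ (raagGen Γ v) = ⟨l₁ v, l₂ v, l₃ v, 0, 0, 0⟩ := raagLift_gen _ _ v

@[simp] lemma unitriRep_e12 (g : RAAG Γ) : (unitriRep l₁ l₂ l₃ h₁ h₂ g).e12 = ex l₁ g := by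
  induction g using raag_induction <;> simp_all

@[simp] lemma unitriRep_e23 (g : RAAG Γ) : (unitriRep l₁ l₂ l₃ h₁ h₂ g).e23 = ex l₂ g := by
  induction g using raag_induction <;> simp_all

@[simp] lemma unitriRep_e34 (g : RAAG Γ) : (unitriRep l₁ l₂ l₃ h₁ h₂ g).e34 = ex l₃ g := by
  induction g using raag_induction <;> simp_all

end Rep

/-- Edge-isotropic characters of `A(Γ)` are isotropic on all commuting pairs. -/
lemma EdgeIso.of_commute {l k : V → ℤ} (h : EdgeIso Γ l k) {g g' : RAAG Γ} (hg : Commute g g') :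
    ex l g * ex k g' = ex l g' * ex k g := by
  have h0 : EdgeIso Γ k 0 := fun _ _ _ => by simp
  have := congrArg (fun x => (unitriRep l k 0 h h0 x).e13) hg.eq
  simp only [map_mul, Unitri.mul_e13, unitriRep_e12, unitriRep_e23] at this
  linarith

open Classical in
/-- The indicator function of a vertex. -/
noncomputable def ind (a : V) : V → ℤ := fun v => if v = a then 1 else 0

@[simp] lemma ind_self (a : V) : ind a a = 1 := by simp [ind]

lemma ind_ne {a v : V} (h : v ≠ a) : ind a v = 0 := by simp [ind, h]

lemma edgeIso_ind {a b : V} (h : ¬Γ.Adj a b) : EdgeIso Γ (ind a) (ind b) := by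
  intro u v huv
  simp only [ind]
  split_ifs <;> simp_all [Γ.adj_comm]

/-- Pairing a vertex with the combination of two isotropic characters vanishing there. -/
lemma EdgeIso.ind_combination {l k : V → ℤ} (h : EdgeIso Γ l k) (v : V) :
    EdgeIso Γ (ind v) (fun t => l v * k t - k v * l t) := by
  intro s t hst
  have h1 := h s t hst
  simp only [ind]
  split_ifs with hs ht ht
  · simp_all
  · subst hs; linarith
  · subst ht; linarith
  · simp

lemma ex_combination (l k : V → ℤ) (c d : ℤ) (g : RAAG Γ) :
    ex (fun t => c * k t - d * l t) g = c * ex k g - d * ex l g := by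
  induction g using raag_induction <;> simp_all <;> ring

lemma ex_eq_zero_of_commute {a v : V} (hne : v ≠ a) (hadj : ¬Γ.Adj v a) {c : RAAG Γ}
    (hc : Commute (raagGen Γ v) c) : ex (ind a) c = 0 := by
  simpa [ind_ne hne] using (edgeIso_ind hadj).of_commute hc

end Raag

/-- An algebraic obstruction to the existence of certain characters on a right-angled Artin
group. -/
lemma raag_obstruction {n : ℕ} {Δ : SimpleGraph (Fin n)} (α β η θ ε : Fin n → ℤ)
    (hαβ : EdgeIso Δ α β) (hηθ : EdgeIso Δ η θ) (hγε : EdgeIso Δ (α + η) ε)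
    (x z a b u : RAAG Δ) (hxb : Commute x b) (hza : Commute z a)
    (hu : Commute u (a * x⁻¹))
    (αx : ex α x = 0) (βx : ex β x = 0) (αa : ex α a = 1) (αb : ex α b = 0) (βb : ex β b = 1)
    (ηx : ex η x = 1) (ηz : ex η z = 0) (ηa : ex η a = 0) (θz : ex θ z = 1) (θa : ex θ a = 0)
    (εa : ex ε a = 0) (εx : ex ε x = 0) (γu : ex (α + η) u = 0) (εu : ex ε u = 1) : False := by
  have hsum (l : Fin n → ℤ) (g : RAAG Δ) : ex l g = ∑ v, l v * ex (ind v) g := by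
    induction g using raag_induction with
    | gen v => simp [ind]
    | one => simp
    | mul g h hg hh => simp [hg, hh, mul_add, Finset.sum_add_distrib]
    | inv g hg => simp [hg]
  have hadd (g : RAAG Δ) : ex (α + η) g = ex α g + ex η g := by
    simp [hsum (α + η), hsum α, hsum η, add_mul, Finset.sum_add_distrib]
  obtain ⟨v, -, hv⟩ := Finset.exists_ne_zero_of_sum_ne_zero
    (s := Finset.univ) (f := fun v => α v * ex (ind v) a) (by rw [← hsum, αa]; exact one_ne_zero)
  obtain ⟨hαv, hva⟩ := mul_ne_zero_iff.1 hv
  have hvx : ex (ind v) x = 0 := by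
    have := (hαβ.ind_combination v).of_commute hxb
    simpa [ex_combination, αx, βx, αb, βb, hαv] using this
  have hηv : η v = 0 := by
    have := (hηθ.ind_combination v).of_commute hza
    simpa [ex_combination, ηz, θz, ηa, θa, hva] using this
  have := (hγε.ind_combination v).of_commute hu
  rw [ex_combination, ex_combination] at this
  rw [hadd] at γu
  simp only [ex_mul, ex_inv, hadd, αa, ηa, αx, ηx, εa, εx, hvx, γu, εu] at this
  simp [hηv, hαv, hva] at this

section Psa

variable {V : Type} {Γ : SimpleGraph V}

lemma PSA.exists_conj {φ : MulAut (RAAG Γ)} (hφ : φ ∈ PSA Γ) (v : V) :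
    ∃ g, φ (raagGen Γ v) = g * raagGen Γ v * g⁻¹ := by
  obtain ⟨g, hg⟩ := isConj_iff.1 (hφ v)
  exact ⟨g, hg.symm⟩

lemma PSA.ex_apply {φ : MulAut (RAAG Γ)} (hφ : φ ∈ PSA Γ) (l : V → ℤ) (k : RAAG Γ) :
    ex l (φ k) = ex l k := by
  induction k using raag_induction with
  | gen v => obtain ⟨g, hg⟩ := PSA.exists_conj hφ v; simp [hg]
  | one => simp
  | mul g h hg hh => simp [hg, hh]
  | inv g hg => simp [hg]

lemma ex_conj_unique {a v : V} (hne : v ≠ a) (hadj : ¬Γ.Adj v a) {g h : RAAG Γ}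
    (hgh : g * raagGen Γ v * g⁻¹ = h * raagGen Γ v * h⁻¹) : ex (ind a) g = ex (ind a) h := by
  have hc : Commute (raagGen Γ v) (h⁻¹ * g) := by
    rw [mul_inv_eq_iff_eq_mul] at hgh
    change _ * (h⁻¹ * g) = h⁻¹ * g * _
    rw [mul_assoc, hgh]; group
  have := ex_eq_zero_of_commute hne hadj hc
  simp at this
  linarith

/-- The exponent sum of `a` in an element conjugating `v` to its image. -/
noncomputable def psaChar (a v : V) (hne : v ≠ a) (hadj : ¬Γ.Adj v a) :
    PSA Γ →* Multiplicative ℤ :=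
  MonoidHom.mk' (fun φ => expSum (ind a) (PSA.exists_conj φ.2 v).choose) (by
    intro φ ψ
    have hφ := (PSA.exists_conj φ.2 v).choose_spec
    have hψ := (PSA.exists_conj ψ.2 v).choose_spec
    have hφψ := (PSA.exists_conj (φ * ψ).2 v).choose_spec
    set g := (PSA.exists_conj φ.2 v).choose
    set h := (PSA.exists_conj ψ.2 v).choose
    apply Multiplicative.toAdd.injective
    change ex _ _ = ex _ g + ex _ h
    rw [← PSA.ex_apply φ.2 _ h, add_comm, ← ex_mul]
    apply ex_conj_unique hne hadj
    rw [← hφψ]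
    simp [hφ, hψ, mul_assoc])

lemma psaChar_apply {a v : V} (hne : v ≠ a) (hadj : ¬Γ.Adj v a) (φ : PSA Γ) {g : RAAG Γ}
    (hg : φ.1 (raagGen Γ v) = g * raagGen Γ v * g⁻¹) :
    (psaChar a v hne hadj φ).toAdd = ex (ind a) g :=
  ex_conj_unique hne hadj ((PSA.exists_conj φ.2 v).choose_spec.symm.trans hg)

/-- The second-order identity satisfied by the conjugators of a commuting pair. -/
lemma commuting_identity {a b i : V} (hab : ¬Γ.Adj a b) (hne : a ≠ b) (hia : ¬Γ.Adj i a)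
    (hib : ¬Γ.Adj i b) (hine : i ≠ b) {φ ψ : MulAut (RAAG Γ)} (hφ : φ ∈ PSA Γ) (hψ : ψ ∈ PSA Γ)
    (hcomm : φ * ψ = ψ * φ) {g h ga gb ha hb : RAAG Γ}
    (hg : φ (raagGen Γ i) = g * raagGen Γ i * g⁻¹) (hh : ψ (raagGen Γ i) = h * raagGen Γ i * h⁻¹)
    (hga : φ (raagGen Γ a) = ga * raagGen Γ a * ga⁻¹)
    (hgb : φ (raagGen Γ b) = gb * raagGen Γ b * gb⁻¹)
    (hha : ψ (raagGen Γ a) = ha * raagGen Γ a * ha⁻¹)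
    (hhb : ψ (raagGen Γ b) = hb * raagGen Γ b * hb⁻¹) :
    ex (ind a) gb * ex (ind b) h - ex (ind b) ga * ex (ind a) h + ex (ind a) h * ex (ind b) g =
    ex (ind a) hb * ex (ind b) g - ex (ind b) ha * ex (ind a) g +
      ex (ind a) g * ex (ind b) h := by
  set f := unitriRep (ind i) (ind a) (ind b) (edgeIso_ind hia) (edgeIso_ind hab) with hf
  have f23 (k : RAAG Γ) : (f k).e23 = ex (ind a) k := unitriRep_e23 ..
  have f34 (k : RAAG Γ) : (f k).e34 = ex (ind b) k := unitriRep_e34 ..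
  have key : ∀ {φ : MulAut (RAAG Γ)}, φ ∈ PSA Γ → ∀ {ga gb : RAAG Γ},
      φ (raagGen Γ a) = ga * raagGen Γ a * ga⁻¹ → φ (raagGen Γ b) = gb * raagGen Γ b * gb⁻¹ →
      ∀ k, (f (φ k)).e24 =
        (f k).e24 + ex (ind a) gb * ex (ind b) k - ex (ind b) ga * ex (ind a) k := by
    intro φ hφ ga gb hga hgb k
    induction k using raag_induction with
    | gen v =>
      by_cases hva : v = a
      · subst hva
        simp [hga, hf, ind_ne hne]; ring
      by_cases hvb : v = b
      · subst hvb
        simp [hgb, hf, ind_ne hne.symm]; ring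
      obtain ⟨gv, hgv⟩ := PSA.exists_conj hφ v
      simp [hgv, hf, ind_ne hva, ind_ne hvb]
    | one => simp
    | mul g h hg hh => simp [hg, hh, f23, f34, PSA.ex_apply hφ]; ring
    | inv g hg => simp [hg, f23, f34, PSA.ex_apply hφ]; ring
  set c := (ψ g * h)⁻¹ * (φ h * g) with hc
  have hcc : Commute (raagGen Γ i) c := by
    have h1 : φ (ψ (raagGen Γ i)) = ψ (φ (raagGen Γ i)) := DFunLike.congr_fun hcomm _
    rw [hg, hh] at h1
    simp only [map_mul, map_inv, hg, hh] at h1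
    have h2 : φ h * g * raagGen Γ i * (φ h * g)⁻¹ = ψ g * h * raagGen Γ i * (ψ g * h)⁻¹ := by
      simpa [mul_assoc] using h1
    rw [mul_inv_eq_iff_eq_mul] at h2
    change _ * c = c * _
    rw [hc, mul_assoc _ (φ h * g), h2]; group
  have hcb : ex (ind b) c = 0 := ex_eq_zero_of_commute hine hib hcc
  have hcq : (f c).e24 = 0 := by
    have := congrArg (fun t => (f t).e14) hcc.eq
    simpa [hf, ind_ne hine] using this
  have heq : φ h * g = ψ g * h * c := by rw [hc]; group
  have := congrArg (fun t => (f t).e24) heq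
  simp only [map_mul, Unitri.mul_e24, key hφ hga hgb, key hψ hha hhb, hcq] at this
  simp only [f23, f34, PSA.ex_apply hφ, PSA.ex_apply hψ, hcb] at this
  linarith

lemma psaChar_isotropic {a b : V} (hab : ¬Γ.Adj a b) (hba : ¬Γ.Adj b a) (hne : a ≠ b)
    {φ ψ : PSA Γ} (h : Commute φ ψ) :
    (psaChar a b hne.symm hba φ).toAdd * (psaChar b a hne hab ψ).toAdd =
      (psaChar a b hne.symm hba ψ).toAdd * (psaChar b a hne hab φ).toAdd := by
  obtain ⟨ga, hga⟩ := PSA.exists_conj φ.2 a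
  obtain ⟨gb, hgb⟩ := PSA.exists_conj φ.2 b
  obtain ⟨ha, hha⟩ := PSA.exists_conj ψ.2 a
  obtain ⟨hb, hhb⟩ := PSA.exists_conj ψ.2 b
  rw [psaChar_apply _ _ φ hga, psaChar_apply _ _ φ hgb, psaChar_apply _ _ ψ hha,
    psaChar_apply _ _ ψ hhb]
  have := commuting_identity hab hne (Γ.irrefl) hab hne φ.2 ψ.2 (congrArg Subtype.val h.eq)
    hga hha hga hgb hha hhb
  linarith

lemma psaChar_sub_isotropic {a b m : V} (hab : ¬Γ.Adj a b) (hba : ¬Γ.Adj b a) (hne : a ≠ b)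
    (hma : ¬Γ.Adj m a) (hmb : ¬Γ.Adj m b) (hnea : m ≠ a) (hneb : m ≠ b)
    {φ ψ : PSA Γ} (h : Commute φ ψ) :
    ((psaChar a m hnea hma φ).toAdd - (psaChar a b hne.symm hba φ).toAdd) *
      ((psaChar b m hneb hmb ψ).toAdd - (psaChar b a hne hab ψ).toAdd) =
    ((psaChar a m hnea hma ψ).toAdd - (psaChar a b hne.symm hba ψ).toAdd) *
      ((psaChar b m hneb hmb φ).toAdd - (psaChar b a hne hab φ).toAdd) := by
  have h0 := psaChar_isotropic hab hba hne h
  obtain ⟨ga, hga⟩ := PSA.exists_conj φ.2 a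
  obtain ⟨gb, hgb⟩ := PSA.exists_conj φ.2 b
  obtain ⟨gm, hgm⟩ := PSA.exists_conj φ.2 m
  obtain ⟨ha, hha⟩ := PSA.exists_conj ψ.2 a
  obtain ⟨hb, hhb⟩ := PSA.exists_conj ψ.2 b
  obtain ⟨hm, hhm⟩ := PSA.exists_conj ψ.2 m
  rw [psaChar_apply _ _ φ hga, psaChar_apply _ _ φ hgb, psaChar_apply _ _ ψ hha,
    psaChar_apply _ _ ψ hhb] at h0 ⊢
  rw [psaChar_apply hnea _ φ hgm, psaChar_apply hneb _ φ hgm, psaChar_apply hnea _ ψ hhm,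
    psaChar_apply hneb _ ψ hhm]
  have := commuting_identity hab hne hma hmb hneb φ.2 ψ.2 (congrArg Subtype.val h.eq)
    hgm hhm hga hgb hha hhb
  linarith

open Classical in
/-- Conjugation of the vertices in `M` by `s`, as an endomorphism of `A(Γ)`. -/
noncomputable def conjOn (M : Set V) (s : RAAG Γ)
    (hs : ∀ u ∈ M, ∀ v ∉ M, Γ.Adj u v → Commute s (raagGen Γ v)) : RAAG Γ →* RAAG Γ :=
  raagLift (fun v => if v ∈ M then s * raagGen Γ v * s⁻¹ else raagGen Γ v) (fun u v huv => by
    have huv' := (raagGen_commute huv).eq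
    have hconj : (s * raagGen Γ u * s⁻¹) * (s * raagGen Γ v * s⁻¹) =
        (s * raagGen Γ v * s⁻¹) * (s * raagGen Γ u * s⁻¹) := by
      simpa using congrArg (MulAut.conj s) huv'
    split_ifs with hu hv hv
    · exact hconj
    · rwa [mul_inv_eq_of_eq_mul (hs u hu v hv huv).eq] at hconj
    · rwa [mul_inv_eq_of_eq_mul (hs v hv u hu huv.symm).eq] at hconj
    · exact huv')

lemma conjOn_mem {M : Set V} {s : RAAG Γ} (hs) {v : V} (hv : v ∈ M) :
    conjOn M s hs (raagGen Γ v) = s * raagGen Γ v * s⁻¹ := by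
  simp [conjOn, hv]

lemma conjOn_notMem {M : Set V} {s : RAAG Γ} (hs) {v : V} (hv : v ∉ M) :
    conjOn M s hs (raagGen Γ v) = raagGen Γ v := by
  simp [conjOn, hv]

lemma conjOn_comp {M : Set V} {s : RAAG Γ} (hs) (hs') (hfix : conjOn M s⁻¹ hs' s = s) :
    (conjOn M s⁻¹ hs').comp (conjOn M s hs) = MonoidHom.id _ := by
  refine raag_hom_ext fun v => ?_
  by_cases hv : v ∈ M
  · simp [conjOn_mem _ hv, hfix, mul_assoc]
  · simp [conjOn_notMem _ hv]

/-- Conjugating by a vertex outside `M` all the vertices of `M`, where `M` is separated from the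
rest of the graph by the link of that vertex, is a pure symmetric automorphism. -/
lemma exists_psa_conjOn {M : Set V} {a : V} (ha : a ∉ M)
    (hM : ∀ u ∈ M, ∀ v ∉ M, Γ.Adj u v → Γ.Adj a v) :
    ∃ φ : PSA Γ, (∀ v ∈ M, φ.1 (raagGen Γ v) = raagGen Γ a * raagGen Γ v * (raagGen Γ a)⁻¹) ∧
      ∀ v ∉ M, φ.1 (raagGen Γ v) = raagGen Γ v := by
  have hs : ∀ u ∈ M, ∀ v ∉ M, Γ.Adj u v → Commute (raagGen Γ a) (raagGen Γ v) :=
    fun u hu v hv huv => raagGen_commute (hM u hu v hv huv)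
  have hs' : ∀ u ∈ M, ∀ v ∉ M, Γ.Adj u v → Commute (raagGen Γ a)⁻¹ (raagGen Γ v) :=
    fun u hu v hv huv => (hs u hu v hv huv).inv_left
  have hs'' : ∀ u ∈ M, ∀ v ∉ M, Γ.Adj u v → Commute (raagGen Γ a)⁻¹⁻¹ (raagGen Γ v) :=
    fun u hu v hv huv => (hs' u hu v hv huv).inv_left
  have h₁ := conjOn_comp hs hs' (conjOn_notMem hs' ha)
  have h₂ := conjOn_comp hs' hs'' (by rw [map_inv, conjOn_notMem hs'' ha])
  simp only [inv_inv] at h₂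
  refine ⟨⟨MonoidHom.toMulEquiv _ _ h₁ h₂, fun v => ?_⟩, fun v hv => conjOn_mem hs hv,
    fun v hv => conjOn_notMem hs hv⟩
  by_cases hv : v ∈ M
  · exact isConj_iff.2 ⟨raagGen Γ a, (conjOn_mem hs hv).symm⟩
  · exact isConj_iff.2 ⟨1, by simpa using (conjOn_notMem hs hv).symm⟩

/-- The inner automorphism of `g` as a pure symmetric automorphism. -/
def psaInner (g : RAAG Γ) : PSA Γ :=
  ⟨MulAut.conj g, fun _ => isConj_iff.2 ⟨g, rfl⟩⟩

lemma commute_psaInner {φ : PSA Γ} {g : RAAG Γ} (h : φ.1 g = g) : Commute φ (psaInner g) := by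
  apply Subtype.ext
  apply MulEquiv.ext
  intro k
  simp [psaInner, h]

end Psa

lemma IsCompOf.adj_mem {V : Type} {Γ : SimpleGraph V} {S M : Set V} (h : IsCompOf Γ S M)
    {u v : V} (hu : u ∈ M) (huv : Γ.Adj u v) (hv : v ∈ S) : v ∈ M := by
  obtain ⟨c, rfl⟩ := h
  obtain ⟨u', hu', rfl⟩ := hu
  exact ⟨⟨v, hv⟩, c.mem_supp_of_adj_mem_supp hu' huv, rfl⟩

lemma IsCompOf.nonempty_s1 {V : Type} {Γ : SimpleGraph V} {S M : Set V} (h : IsCompOf Γ S M) :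
    M.Nonempty := by
  obtain ⟨c, rfl⟩ := h
  exact c.nonempty_supp.image _

/-- Proposition 5.7. If `Γ` contains a SIL, then `PΣ(A(Γ))` is not
isomorphic to any right-angled Artin group. -/
theorem psa_not_raag_of_sil {V : Type} [Fintype V] (Γ : SimpleGraph V) (h : HasSIL Γ) :
    ¬∃ (n : ℕ) (Δ : SimpleGraph (Fin n)), Nonempty (↥(PSA Γ) ≃* RAAG Δ) := by
  rintro ⟨n, Δ, ⟨Φ⟩⟩
  obtain ⟨a, b, hne, hab, M, hM, haM, hbM⟩ := h
  have hba : ¬Γ.Adj b a := fun h => hab h.symm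
  obtain ⟨m, hm⟩ := hM.nonempty_s1
  have hsep : ∀ u ∈ M, ∀ v ∉ M, Γ.Adj u v → Γ.Adj a v ∧ Γ.Adj b v := by
    intro u hu v hv huv
    by_contra hcon
    exact hv (hM.adj_mem hu huv hcon)
  have hma : ¬Γ.Adj m a := fun h => Γ.irrefl (hsep m hm a haM h).1
  have hmb : ¬Γ.Adj m b := fun h => Γ.irrefl (hsep m hm b hbM h).2
  have ham : ¬Γ.Adj a m := fun h => hma h.symm
  have hnea : m ≠ a := fun h => haM (h ▸ hm)
  have hneb : m ≠ b := fun h => hbM (h ▸ hm)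
  obtain ⟨x, hx, hx'⟩ := exists_psa_conjOn haM fun u hu v hv huv => (hsep u hu v hv huv).1
  obtain ⟨z, hz, hz'⟩ := exists_psa_conjOn hbM fun u hu v hv huv => (hsep u hu v hv huv).2
  let A : PSA Γ := psaInner (raagGen Γ a)
  let B : PSA Γ := psaInner (raagGen Γ b)
  let U : PSA Γ := psaInner (raagGen Γ m)
  let χab := psaChar a b hne.symm hba
  let χba := psaChar b a hne hab
  let χam := psaChar a m hnea hma
  let χbm := psaChar b m hneb hmb
  let χma := psaChar m a hnea.symm ham
  -- transport of characters along the isomorphism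
  let val (χ : PSA Γ →* Multiplicative ℤ) (v : Fin n) : ℤ := (χ (Φ.symm (raagGen Δ v))).toAdd
  have hval (χ : PSA Γ →* Multiplicative ℤ) (φ : PSA Γ) : ex (val χ) (Φ φ) = (χ φ).toAdd := by
    have := ex_unique (val χ) (χ.comp Φ.symm.toMonoidHom) (fun v => rfl) (Φ φ)
    rw [← this]
    simp
  have hgen {u v : Fin n} (huv : Δ.Adj u v) :
      Commute (Φ.symm (raagGen Δ u)) (Φ.symm (raagGen Δ v)) := (raagGen_commute huv).map Φ.symm
  have hη (φ : PSA Γ) : ex (val (χam / χab)) (Φ φ) = (χam φ).toAdd - (χab φ).toAdd := by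
    rw [hval]; simp
  have hθ (φ : PSA Γ) : ex (val (χbm / χba)) (Φ φ) = (χbm φ).toAdd - (χba φ).toAdd := by
    rw [hval]; simp
  have hγ : val χab + val (χam / χab) = val χam := by
    funext v; simp [val]
  have inner (g : RAAG Γ) (v : V) :
      (psaInner g).1 (raagGen Γ v) = g * raagGen Γ v * g⁻¹ := rfl
  have hfix {φ : PSA Γ} {v : V} (h : φ.1 (raagGen Γ v) = raagGen Γ v) :
      φ.1 (raagGen Γ v) = 1 * raagGen Γ v * 1⁻¹ := by simpa using h
  have xa := hx' a haM
  have xb := hx' b hbM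
  have xm := hx m hm
  have za := hz' a haM
  have zb := hz' b hbM
  have zm := hz m hm
  have hU : Commute U (A * x⁻¹) := by
    refine (commute_psaInner ?_).symm
    have : x.1⁻¹ (raagGen Γ m) = (raagGen Γ a)⁻¹ * raagGen Γ m * raagGen Γ a := by
      rw [MulAut.inv_apply, MulEquiv.symm_apply_eq]
      simp [xa, xm, mul_assoc]
    change A.1 (x.1⁻¹ (raagGen Γ m)) = _
    rw [this]
    simp [A, psaInner, mul_assoc]
  refine raag_obstruction (val χab) (val χba) (val (χam / χab)) (val (χbm / χba)) (val χma)
    ?_ ?_ ?_ (Φ x) (Φ z) (Φ A) (Φ B) (Φ U)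
    ((commute_psaInner xb).map Φ) ((commute_psaInner za).map Φ)
    (by simpa using hU.map Φ) ?_ ?_ ?_ ?_ ?_ ?_ ?_ ?_ ?_ ?_ ?_ ?_ ?_ ?_
  · exact fun u v huv => psaChar_isotropic hab hba hne (hgen huv)
  · exact fun u v huv => psaChar_sub_isotropic hab hba hne hma hmb hnea hneb (hgen huv)
  · rw [hγ]
    exact fun u v huv => psaChar_isotropic ham hma hnea.symm (hgen huv)
  · rw [hval, psaChar_apply _ _ _ (hfix xb), ex_one]
  · rw [hval, psaChar_apply _ _ _ (hfix xa), ex_one]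
  · rw [hval, psaChar_apply _ _ _ (inner _ _), ex_gen, ind_self]
  · rw [hval, psaChar_apply _ _ _ (inner _ _), ex_gen, ind_ne hne.symm]
  · rw [hval, psaChar_apply _ _ _ (inner _ _), ex_gen, ind_self]
  · rw [hη, psaChar_apply _ _ _ xm, psaChar_apply _ _ _ (hfix xb)]; simp
  · rw [hη, psaChar_apply _ _ _ zm, psaChar_apply _ _ _ (hfix zb)]; simp [ind_ne hne.symm]
  · rw [hη, psaChar_apply _ _ _ (inner _ _), psaChar_apply _ _ _ (inner _ _)]; simp
  · rw [hθ, psaChar_apply _ _ _ zm, psaChar_apply _ _ _ (hfix za)]; simp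
  · rw [hθ, psaChar_apply _ _ _ (inner _ _), psaChar_apply _ _ _ (inner _ _)]; simp
  · rw [hval, psaChar_apply _ _ _ (inner _ _), ex_gen, ind_ne hnea.symm]
  · rw [hval, psaChar_apply _ _ _ (hfix xa), ex_one]
  · rw [hγ, hval, psaChar_apply _ _ _ (inner _ _), ex_gen, ind_ne hnea]
  · rw [hval, psaChar_apply _ _ _ (inner _ _), ex_gen, ind_self]
end
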